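/- Let n be a positive integer with n ≡ 3 (mod 4). Then Σ_{k=0}^{n-1} [6k+1]·(q;q²)_k²·(q²;q⁴)_k·(q;q⁴)_k² / ((q²;q²)_k²·(q⁴;q⁴)_k³) · q^{2k} ≡ [3n]·(q^{2n}(2-q^n)/(1+q^n)²)·((q²;q⁴)_{(3n-1)/4})² / ((q⁴;q⁴)_{(3n-1)/4})² modulo [n]·Φ_n(q)⁴. -/

import Mathlib

/-- The q-shifted factorial `(x;q)_k = (1-x)(1-xq)⋯(1-xq^{k-1})`. -/
def qPoch {K : Type*} [Field K] (x q : K) (k : ℕ) : K :=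
  ∏ i ∈ Finset.range k, (1 - x * q ^ i)

/-- The q-integer `[r] = 1 + q + ⋯ + q^{r-1}`. -/
def qint {K : Type*} [Field K] (q : K) (r : ℕ) : K :=
  ∑ i ∈ Finset.range r, q ^ i

section QuadraticSummation

variable {K : Type*} [Field K]

lemma qPoch_zero (x q : K) : qPoch x q 0 = 1 := by simp [qPoch]

lemma qPoch_succ (x q : K) (k : ℕ) : qPoch x q (k + 1) = qPoch x q k * (1 - x * q ^ k) := by
  simp [qPoch, Finset.prod_range_succ]

lemma qPoch_shift (x q : K) (k : ℕ) :
    (1 - x) * qPoch (x * q) q k = qPoch x q k * (1 - x * q ^ k) := by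
  induction k with
  | zero => simp [qPoch]
  | succ k ih =>
    rw [qPoch_succ, qPoch_succ, ← mul_assoc, ih]
    ring

lemma qPoch_ne_zero {x q : K} (h : ∀ i : ℕ, 1 - x * q ^ i ≠ 0) (k : ℕ) : qPoch x q k ≠ 0 :=
  Finset.prod_ne_zero_iff.2 fun i _ => h i

lemma qPoch_eq_zero {x q : K} {i k : ℕ} (hik : i < k) (h : x * q ^ i = 1) : qPoch x q k = 0 :=
  Finset.prod_eq_zero (Finset.mem_range.2 hik) (by rw [h, sub_self])

/-- The summand of Gasper and Rahman's quadratic summation in base `q ^ 2` with leading parameter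
`q`, up to the factor `1 - q`; the parameters `d`, `f`, `g` are subject to `d * f * g = q ^ 4`. -/
def quadTerm (q c d f g : K) (k : ℕ) : K :=
  (1 - q ^ (6 * k + 1)) *
    (qPoch q (q ^ 2) k * qPoch (c * q) (q ^ 2) k * qPoch (q / c) (q ^ 2) k *
      (qPoch d (q ^ 4) k * qPoch f (q ^ 4) k * qPoch g (q ^ 4) k)) /
    (qPoch (q ^ 4) (q ^ 4) k * qPoch (c * q ^ 4) (q ^ 4) k * qPoch (q ^ 4 / c) (q ^ 4) k *
      (qPoch (q ^ 3 / d) (q ^ 2) k * qPoch (q ^ 3 / f) (q ^ 2) k * qPoch (q ^ 3 / g) (q ^ 2) k)) *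
    q ^ (2 * k)

lemma quadratic_certificate {q x c e g : K} (hc : c ≠ 0) (he : e ≠ 0) (hg : g ≠ 0) (hq : q ≠ 0) :
    (g - e) * (e * g) *
      ((1 - q * x) * (1 - c * q * x) * (1 - q / c * x) *
          ((1 - e * x ^ 2) * (1 - x ^ 2 / (e * g)) * (1 - g * x ^ 2)) -
        (1 - x ^ 2) * (1 - x ^ 2 / c) * (1 - c * x ^ 2) *
          ((1 - q / e * x) * (1 - q * e * g * x) * (1 - q / g * x))) =
      q * x * (1 - q * x ^ 3) *
        (g ^ 2 * (1 - e) * (1 - c * e) * (1 - e / c) *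
            ((1 - g * x ^ 2) * (1 - q / g * x) * (1 - 1 / (q * g) * x)) -
          e ^ 2 * (1 - g) * (1 - c * g) * (1 - g / c) *
            ((1 - e * x ^ 2) * (1 - q / e * x) * (1 - 1 / (q * e) * x))) := by
  field_simp
  ring

lemma cubic_certificate {q x c : K} (hc : c ≠ 0) (hq : q ≠ 0) :
    (1 - c ^ 2 * q ^ 4) * (c * q ^ 3) *
      ((1 - q * x) * (1 - c * q * x) * (1 - x / (q ^ 3 * c)) *
          ((1 - q ^ 2 * x ^ 2) * (1 - q * x ^ 2) ^ 2) -
        (1 - x ^ 2) * (1 - c * q ^ 4 * x ^ 2) * (1 - x ^ 2 / c) *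
          ((1 - x / q) * (1 - x) ^ 2)) =
      x * (1 - q * x ^ 3) * (1 - c * q ^ 2) *
        (-(1 - c * q ^ 3) ^ 2 *
            ((1 - c * q * x) * (1 - c * q ^ 3 * x) * (1 - x ^ 2 / c)) -
          c * q ^ 4 * (1 - c * q) ^ 2 *
            ((1 - x / (q ^ 3 * c)) * (1 - x / (q * c)) * (1 - c * q ^ 4 * x ^ 2))) := by
  field_simp
  ring

lemma quadTerm_swap (q c d f g : K) (k : ℕ) : quadTerm q c d f g k = quadTerm q c g f d k := by
  simp only [quadTerm]
  ring

/-- `quadTerm` without its factor `1 - q ^ (6 * k + 1)`. -/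
def quadAux (q c e f g : K) (k : ℕ) : K :=
  (qPoch q (q ^ 2) k * qPoch (c * q) (q ^ 2) k * qPoch (q / c) (q ^ 2) k *
      (qPoch e (q ^ 4) k * qPoch f (q ^ 4) k * qPoch g (q ^ 4) k)) /
    (qPoch (q ^ 4) (q ^ 4) k * qPoch (c * q ^ 4) (q ^ 4) k * qPoch (q ^ 4 / c) (q ^ 4) k *
      (qPoch (q ^ 3 / e) (q ^ 2) k * qPoch (q ^ 3 / f) (q ^ 2) k * qPoch (q ^ 3 / g) (q ^ 2) k)) *
    q ^ (2 * k)

lemma quadAux_swap (q c d f g : K) (k : ℕ) : quadAux q c d f g k = quadAux q c g f d k := by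
  simp only [quadAux]
  ring

lemma quadTerm_shift {q c e f g : K} (hq : q ≠ 0) (hg : g ≠ 0)
    (hgQ : ∀ i : ℕ, 1 - 1 / (q * g) * (q ^ 2) ^ i ≠ 0) (k : ℕ) :
    (1 - g) * (1 - 1 / (q * g)) * (1 - q / g) * quadTerm q c e f (g * q ^ 4) k =
      quadAux q c e f g k * (1 - q * (q ^ (2 * k)) ^ 3) *
        ((1 - g * (q ^ (2 * k)) ^ 2) * (1 - q / g * q ^ (2 * k)) *
          (1 - 1 / (q * g) * q ^ (2 * k))) := by
  have hx2 : (q ^ 2) ^ k = q ^ (2 * k) := by ring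
  have hx4 : (q ^ 4) ^ k = (q ^ (2 * k)) ^ 2 := by ring
  have hx6 : q ^ (6 * k + 1) = q * (q ^ (2 * k)) ^ 3 := by ring
  have h1 := qPoch_shift g (q ^ 4) k
  have h2 := qPoch_shift (1 / (q * g)) (q ^ 2) k
  have h3 := qPoch_shift (q / g) (q ^ 2) k
  rw [hx4] at h1
  rw [hx2] at h2 h3
  have e1 : 1 / (q * g) * q ^ 2 = q / g := by field_simp
  have e2 : q / g * q ^ 2 = q ^ 3 / g := by field_simp
  have e3 : q ^ 3 / (g * q ^ 4) = 1 / (q * g) := by field_simp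
  rw [e1] at h2
  rw [e2] at h3
  have n0 : qPoch (1 / (q * g)) (q ^ 2) k ≠ 0 := qPoch_ne_zero hgQ k
  have n1 : qPoch (q ^ 3 / g) (q ^ 2) k ≠ 0 := qPoch_ne_zero (fun i => by
    have := hgQ (i + 2)
    rwa [show 1 / (q * g) * (q ^ 2) ^ (i + 2) = q ^ 3 / g * (q ^ 2) ^ i by
      rw [pow_add, mul_left_comm, ← e2, ← e1]; ring] at this) k
  have h4 : (1 - 1 / (q * g)) * (1 - q / g) / qPoch (1 / (q * g)) (q ^ 2) k =
      (1 - q / g * q ^ (2 * k)) * (1 - 1 / (q * g) * q ^ (2 * k)) /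
        qPoch (q ^ 3 / g) (q ^ 2) k := by
    rw [div_eq_div_iff n0 n1]
    linear_combination (1 - 1 / (q * g)) * h3 + (1 - q / g * q ^ (2 * k)) * h2
  have h5 : quadTerm q c e f (g * q ^ 4) k =
      qPoch (g * q ^ 4) (q ^ 4) k / qPoch (1 / (q * g)) (q ^ 2) k *
      ((1 - q * (q ^ (2 * k)) ^ 3) *
        (qPoch q (q ^ 2) k * qPoch (c * q) (q ^ 2) k * qPoch (q / c) (q ^ 2) k *
          (qPoch e (q ^ 4) k * qPoch f (q ^ 4) k)) /
        (qPoch (q ^ 4) (q ^ 4) k * qPoch (c * q ^ 4) (q ^ 4) k * qPoch (q ^ 4 / c) (q ^ 4) k *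
          (qPoch (q ^ 3 / e) (q ^ 2) k * qPoch (q ^ 3 / f) (q ^ 2) k)) * q ^ (2 * k)) := by
    rw [quadTerm, e3, hx6]
    simp only [div_eq_mul_inv, mul_inv]
    ring
  rw [h5, quadAux]
  set W := (1 - q * (q ^ (2 * k)) ^ 3) *
        (qPoch q (q ^ 2) k * qPoch (c * q) (q ^ 2) k * qPoch (q / c) (q ^ 2) k *
          (qPoch e (q ^ 4) k * qPoch f (q ^ 4) k)) /
        (qPoch (q ^ 4) (q ^ 4) k * qPoch (c * q ^ 4) (q ^ 4) k * qPoch (q ^ 4 / c) (q ^ 4) k *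
          (qPoch (q ^ 3 / e) (q ^ 2) k * qPoch (q ^ 3 / f) (q ^ 2) k)) * q ^ (2 * k) with hW
  calc _ = ((1 - g) * qPoch (g * q ^ 4) (q ^ 4) k) *
        ((1 - 1 / (q * g)) * (1 - q / g) / qPoch (1 / (q * g)) (q ^ 2) k) * W := by ring
    _ = _ := by
      rw [h1, h4, hW]
      simp only [div_eq_mul_inv, mul_inv]
      ring

/-- The denominator of the term ratio of `quadAux`, as a function of `x = q ^ (2 * k)`. -/
def quadDen (q c e f g x : K) : K :=
  (1 - x ^ 2) * (1 - x ^ 2 / c) * (1 - c * x ^ 2) *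
    ((1 - q / e * x) * (1 - q / f * x) * (1 - q / g * x))

lemma quadAux_succ {q c e f g : K} (h4 : ∀ i : ℕ, 1 - q ^ 4 * (q ^ 4) ^ i ≠ 0)
    (hc4 : ∀ i : ℕ, 1 - c * q ^ 4 * (q ^ 4) ^ i ≠ 0)
    (hc4' : ∀ i : ℕ, 1 - q ^ 4 / c * (q ^ 4) ^ i ≠ 0)
    (he : ∀ i : ℕ, 1 - q ^ 3 / e * (q ^ 2) ^ i ≠ 0)
    (hf : ∀ i : ℕ, 1 - q ^ 3 / f * (q ^ 2) ^ i ≠ 0)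
    (hg : ∀ i : ℕ, 1 - q ^ 3 / g * (q ^ 2) ^ i ≠ 0) (k : ℕ) :
    quadAux q c e f g (k + 1) * quadDen q c e f g (q ^ (2 * (k + 1))) =
      quadAux q c e f g k * (q ^ 2 *
        ((1 - q * q ^ (2 * k)) * (1 - c * q * q ^ (2 * k)) * (1 - q / c * q ^ (2 * k)) *
          ((1 - e * (q ^ (2 * k)) ^ 2) * (1 - f * (q ^ (2 * k)) ^ 2) *
            (1 - g * (q ^ (2 * k)) ^ 2)))) := by
  have h4 := h4 k
  have hc4 := hc4 k
  have hc4' := hc4' k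
  have he := he k
  have hf := hf k
  have hg := hg k
  have hD : quadDen q c e f g (q ^ (2 * (k + 1))) =
      (1 - q ^ 4 * (q ^ 4) ^ k) * (1 - c * q ^ 4 * (q ^ 4) ^ k) * (1 - q ^ 4 / c * (q ^ 4) ^ k) *
      ((1 - q ^ 3 / e * (q ^ 2) ^ k) * (1 - q ^ 3 / f * (q ^ 2) ^ k) *
        (1 - q ^ 3 / g * (q ^ 2) ^ k)) := by
    rw [quadDen]
    ring
  have hx2 : (q ^ 2) ^ k = q ^ (2 * k) := by ring
  have hx4 : (q ^ 4) ^ k = (q ^ (2 * k)) ^ 2 := by ring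
  rw [hD]
  simp only [quadAux, qPoch_succ]
  rw [show q ^ (2 * (k + 1)) = q ^ (2 * k) * q ^ 2 by ring, ← hx4, ← hx2]
  generalize (1 - q ^ 4 * (q ^ 4) ^ k) = a1 at *
  generalize (1 - c * q ^ 4 * (q ^ 4) ^ k) = a2 at *
  generalize (1 - q ^ 4 / c * (q ^ 4) ^ k) = a3 at *
  generalize (1 - q ^ 3 / e * (q ^ 2) ^ k) = a4 at *
  generalize (1 - q ^ 3 / f * (q ^ 2) ^ k) = a5 at *
  generalize (1 - q ^ 3 / g * (q ^ 2) ^ k) = a6 at *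
  have key : a1⁻¹ * a1 * (a2⁻¹ * a2) * (a3⁻¹ * a3) * (a4⁻¹ * a4) * (a5⁻¹ * a5) *
      (a6⁻¹ * a6) = 1 := by
    simp [h4, hc4, hc4', he, hf, hg]
  generalize qPoch (q ^ 4) (q ^ 4) k = b1
  generalize qPoch (c * q ^ 4) (q ^ 4) k = b2
  generalize qPoch (q ^ 4 / c) (q ^ 4) k = b3
  generalize qPoch (q ^ 3 / e) (q ^ 2) k = b4
  generalize qPoch (q ^ 3 / f) (q ^ 2) k = b5
  generalize qPoch (q ^ 3 / g) (q ^ 2) k = b6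
  generalize qPoch q (q ^ 2) k = b7
  generalize qPoch (c * q) (q ^ 2) k = b8
  generalize qPoch (q / c) (q ^ 2) k = b9
  generalize qPoch e (q ^ 4) k = b10
  generalize qPoch f (q ^ 4) k = b11
  generalize qPoch g (q ^ 4) k = b12
  generalize (1 - q * (q ^ 2) ^ k) = a7
  generalize (1 - c * q * (q ^ 2) ^ k) = a8
  generalize (1 - q / c * (q ^ 2) ^ k) = a9
  generalize (1 - e * (q ^ 4) ^ k) = a10
  generalize (1 - f * (q ^ 4) ^ k) = a11
  generalize (1 - g * (q ^ 4) ^ k) = a12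
  simp only [div_eq_mul_inv, mul_inv]
  calc _ = (b7 * b8 * b9 * (b10 * b11 * b12) *
      (b1⁻¹ * b2⁻¹ * b3⁻¹ * (b4⁻¹ * b5⁻¹ * b6⁻¹)) * (q ^ 2) ^ k) *
        (q ^ 2 * (a7 * a8 * a9 * (a10 * a11 * a12))) *
      (a1⁻¹ * a1 * (a2⁻¹ * a2) * (a3⁻¹ * a3) * (a4⁻¹ * a4) * (a5⁻¹ * a5) * (a6⁻¹ * a6)) := by ring
    _ = _ := by rw [key, mul_one]

/-- Contiguous relation for `quadTerm`, in telescoped form. -/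
lemma quadTerm_contiguous {q c e f g : K} (hq : q ≠ 0) (hc : c ≠ 0) (he : e ≠ 0) (hg : g ≠ 0)
    (hefg : e * f * g = 1) (he1 : 1 - e ≠ 0) (hg1 : 1 - g ≠ 0)
    (h4 : ∀ i : ℕ, 1 - q ^ 4 * (q ^ 4) ^ i ≠ 0)
    (hc4 : ∀ i : ℕ, 1 - c * q ^ 4 * (q ^ 4) ^ i ≠ 0)
    (hc4' : ∀ i : ℕ, 1 - q ^ 4 / c * (q ^ 4) ^ i ≠ 0)
    (heQ : ∀ i : ℕ, 1 - 1 / (q * e) * (q ^ 2) ^ i ≠ 0)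
    (hfQ : ∀ i : ℕ, 1 - q ^ 3 / f * (q ^ 2) ^ i ≠ 0)
    (hgQ : ∀ i : ℕ, 1 - 1 / (q * g) * (q ^ 2) ^ i ≠ 0)
    {L : ℕ} (hL : qPoch e (q ^ 4) L = 0) :
    (1 - c * e) * (1 - e / c) * ((g - 1 / q) * (g - q)) *
        ∑ k ∈ Finset.range L, quadTerm q c e f (g * q ^ 4) k =
      (1 - c * g) * (1 - g / c) * ((e - 1 / q) * (e - q)) *
        ∑ k ∈ Finset.range L, quadTerm q c (e * q ^ 4) f g k := by
  have hf : f = 1 / (e * g) := by field_simp; linear_combination hefg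
  have e3 : ∀ {z : K}, z ≠ 0 → (∀ i : ℕ, 1 - 1 / (q * z) * (q ^ 2) ^ i ≠ 0) →
      ∀ i : ℕ, 1 - q ^ 3 / z * (q ^ 2) ^ i ≠ 0 := fun {z} hz h i => by
    have := h (i + 2)
    rwa [show 1 / (q * z) * (q ^ 2) ^ (i + 2) = q ^ 3 / z * (q ^ 2) ^ i by
      field_simp; ring] at this
  have hsucc := quadAux_succ h4 hc4 hc4' (e3 he heQ) hfQ (e3 hg hgQ)
  let G : ℕ → K := fun k => quadAux q c e f g k * quadDen q c e f g (q ^ (2 * k)) / q ^ (2 * k)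
  have htel : ∑ k ∈ Finset.range L, (G (k + 1) - G k) = 0 := by
    rw [Finset.sum_range_sub]
    simp [G, quadAux, hL, quadDen]
  have hk : ∀ k, (1 - e) * (1 - g) * q ^ 3 * ((1 - c * e) * (1 - e / c) * ((g - 1 / q) * (g - q)) *
        quadTerm q c e f (g * q ^ 4) k) -
      (1 - e) * (1 - g) * q ^ 3 * ((1 - c * g) * (1 - g / c) * ((e - 1 / q) * (e - q)) *
        quadTerm q c (e * q ^ 4) f g k) =
      q ^ 2 * ((g - e) * (e * g)) * (G (k + 1) - G k) := by
    intro k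
    have hA := quadTerm_shift (c := c) (e := e) (f := f) hq hg hgQ k
    have hB := quadTerm_shift (c := c) (e := g) (f := f) hq he heQ k
    rw [quadTerm_swap, quadAux_swap] at hB
    have hx : q ^ (2 * k) ≠ 0 := pow_ne_zero _ hq
    have hcert := quadratic_certificate (x := q ^ (2 * k)) hc he hg hq
    have hG : G (k + 1) = quadAux q c e f g k *
        ((1 - q * q ^ (2 * k)) * (1 - c * q * q ^ (2 * k)) * (1 - q / c * q ^ (2 * k)) *
          ((1 - e * (q ^ (2 * k)) ^ 2) * (1 - (q ^ (2 * k)) ^ 2 / (e * g)) *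
            (1 - g * (q ^ (2 * k)) ^ 2))) / q ^ (2 * k) := by
      simp only [G]
      rw [hsucc, show q ^ (2 * (k + 1)) = q ^ 2 * q ^ (2 * k) by ring,
        show f * (q ^ (2 * k)) ^ 2 = (q ^ (2 * k)) ^ 2 / (e * g) by rw [hf]; ring]
      field_simp
    have hG' : G k = quadAux q c e f g k *
        ((1 - (q ^ (2 * k)) ^ 2) * (1 - (q ^ (2 * k)) ^ 2 / c) * (1 - c * (q ^ (2 * k)) ^ 2) *
          ((1 - q / e * q ^ (2 * k)) * (1 - q * e * g * q ^ (2 * k)) *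
            (1 - q / g * q ^ (2 * k)))) / q ^ (2 * k) := by
      simp only [G, quadDen]
      rw [show q / f = q * e * g by rw [hf]; field_simp]
    have hfac : ∀ T N D X Y : K,
        q ^ 2 * Y * (T * N / X - T * D / X) = q ^ 2 * T * (Y * (N - D)) / X := by
      intros
      ring
    rw [hG, hG', hfac, hcert]
    have hg' : (g - 1 / q) * (g - q) = g ^ 2 * ((1 - 1 / (q * g)) * (1 - q / g)) := by
      field_simp
    have he' : (e - 1 / q) * (e - q) = e ^ 2 * ((1 - 1 / (q * e)) * (1 - q / e)) := by
      field_simp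
    rw [hg', he']
    rw [eq_div_iff hx]
    linear_combination (g ^ 2 * (1 - e) * q ^ 3 * (1 - c * e) * (1 - e / c) * q ^ (2 * k)) * hA -
      (e ^ 2 * (1 - g) * q ^ 3 * (1 - c * g) * (1 - g / c) * q ^ (2 * k)) * hB
  have hsum := Finset.sum_congr (rfl : Finset.range L = Finset.range L) fun k _ => hk k
  rw [← Finset.mul_sum, htel, mul_zero, Finset.sum_sub_distrib] at hsum
  simp only [← Finset.mul_sum] at hsum
  have hne : (1 - e) * (1 - g) * q ^ 3 ≠ 0 := mul_ne_zero (mul_ne_zero he1 hg1) (pow_ne_zero _ hq)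
  exact mul_left_cancel₀ hne (sub_eq_zero.1 hsum)

/-- The part of `quadTerm q c q q (q ^ 2)` that depends on neither `c` nor `1 - q ^ (6 * k + 1)`. -/
def cubicAux (q : K) (k : ℕ) : K :=
  qPoch q (q ^ 2) k * (qPoch q (q ^ 4) k * qPoch q (q ^ 4) k * qPoch (q ^ 2) (q ^ 4) k) /
    (qPoch (q ^ 4) (q ^ 4) k *
      (qPoch (q ^ 2) (q ^ 2) k * qPoch (q ^ 2) (q ^ 2) k * qPoch q (q ^ 2) k)) * q ^ (2 * k)

lemma quadTerm_eq_cubicAux {q : K} (hq : q ≠ 0) (c : K) (k : ℕ) :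
    quadTerm q c q q (q ^ 2) k = (1 - q * (q ^ (2 * k)) ^ 3) * cubicAux q k *
      (qPoch (c * q) (q ^ 2) k * qPoch (q / c) (q ^ 2) k /
        (qPoch (c * q ^ 4) (q ^ 4) k * qPoch (q ^ 4 / c) (q ^ 4) k)) := by
  have e1 : q ^ 3 / q = q ^ 2 := by field_simp
  have e2 : q ^ 3 / q ^ 2 = q := by field_simp
  rw [quadTerm, cubicAux, e1, e2, show q ^ (6 * k + 1) = q * (q ^ (2 * k)) ^ 3 by ring]
  simp only [div_eq_mul_inv, mul_inv]
  ring

lemma cubicAux_succ {q : K} (hq : ∀ j : ℕ, 0 < j → q ^ j ≠ 1) (k : ℕ) :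
    cubicAux q (k + 1) * ((1 - q ^ 4 * (q ^ (2 * k)) ^ 2) * ((1 - q * q ^ (2 * k)) *
        (1 - q ^ 2 * q ^ (2 * k)) ^ 2)) =
      cubicAux q k * (q ^ 2 * ((1 - q * q ^ (2 * k)) * ((1 - q ^ 2 * (q ^ (2 * k)) ^ 2) *
        (1 - q * (q ^ (2 * k)) ^ 2) ^ 2))) := by
  have hx2 : (q ^ 2) ^ k = q ^ (2 * k) := by ring
  have hx4 : (q ^ 4) ^ k = (q ^ (2 * k)) ^ 2 := by ring
  have h1 : 1 - q ^ 4 * (q ^ (2 * k)) ^ 2 ≠ 0 := by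
    rw [show q ^ 4 * (q ^ (2 * k)) ^ 2 = q ^ (4 * k + 4) by ring]
    exact sub_ne_zero.2 (hq _ (by omega)).symm
  have h2 : 1 - q * q ^ (2 * k) ≠ 0 := by
    rw [← pow_succ']
    exact sub_ne_zero.2 (hq _ (by omega)).symm
  have h3 : 1 - q ^ 2 * q ^ (2 * k) ≠ 0 := by
    rw [← pow_add]
    exact sub_ne_zero.2 (hq _ (by omega)).symm
  simp only [cubicAux, qPoch_succ]
  rw [show q ^ (2 * (k + 1)) = q ^ (2 * k) * q ^ 2 by ring, hx4, hx2]
  generalize (1 - q ^ 4 * (q ^ (2 * k)) ^ 2) = a1 at *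
  generalize (1 - q * q ^ (2 * k)) = a2 at *
  generalize (1 - q ^ 2 * q ^ (2 * k)) = a3 at *
  have key : a1⁻¹ * a1 * (a2⁻¹ * a2) * (a3⁻¹ * a3) ^ 2 = 1 := by simp [h1, h2, h3]
  simp only [div_eq_mul_inv, mul_inv]
  linear_combination (qPoch q (q ^ 2) k * a2 * (qPoch q (q ^ 4) k *
    (1 - q * (q ^ (2 * k)) ^ 2) * (qPoch q (q ^ 4) k * (1 - q * (q ^ (2 * k)) ^ 2)) *
    (qPoch (q ^ 2) (q ^ 4) k * (1 - q ^ 2 * (q ^ (2 * k)) ^ 2))) *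
    ((qPoch (q ^ 4) (q ^ 4) k)⁻¹ * ((qPoch (q ^ 2) (q ^ 2) k)⁻¹ * (qPoch (q ^ 2) (q ^ 2) k)⁻¹ *
      (qPoch q (q ^ 2) k)⁻¹)) * q ^ (2 * k) * q ^ 2) * key

/-- Contiguous relation in the parameter `c`. -/
lemma quadTerm_contiguous_cubic {q c : K} (hq0 : q ≠ 0) (hq : ∀ j : ℕ, 0 < j → q ^ j ≠ 1)
    (hc : c ≠ 0) (hc2 : 1 - c * q ^ 2 ≠ 0)
    (hc4 : ∀ i : ℕ, 1 - c * q ^ 4 * (q ^ 4) ^ i ≠ 0)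
    (hc4' : ∀ i : ℕ, 1 - 1 / c * (q ^ 4) ^ i ≠ 0)
    {L : ℕ} (hL : qPoch (1 / (q ^ 3 * c)) (q ^ 2) L = 0) :
    (1 - c * q ^ 3) ^ 2 * ((1 - c * q) * (1 - c * q ^ 3) * (1 - 1 / c)) *
        ∑ k ∈ Finset.range L, quadTerm q (c * q ^ 4) q q (q ^ 2) k =
      -(c * q ^ 4 * (1 - c * q) ^ 2 *
        ((1 - 1 / (q ^ 3 * c)) * (1 - 1 / (q * c)) * (1 - c * q ^ 4))) *
        ∑ k ∈ Finset.range L, quadTerm q c q q (q ^ 2) k := by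
  have hc8 : ∀ i : ℕ, 1 - c * q ^ 8 * (q ^ 4) ^ i ≠ 0 := fun i => by
    have := hc4 (i + 1)
    rwa [show c * q ^ 4 * (q ^ 4) ^ (i + 1) = c * q ^ 8 * (q ^ 4) ^ i by ring] at this
  have hc4'' : ∀ i : ℕ, 1 - q ^ 4 / c * (q ^ 4) ^ i ≠ 0 := fun i => by
    have := hc4' (i + 1)
    rwa [show 1 / c * (q ^ 4) ^ (i + 1) = q ^ 4 / c * (q ^ 4) ^ i by ring] at this
  let T : ℕ → K := fun k => cubicAux q k * (qPoch (c * q) (q ^ 2) k *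
    qPoch (1 / (q ^ 3 * c)) (q ^ 2) k /
      (qPoch (c * q ^ 8) (q ^ 4) k * qPoch (q ^ 4 / c) (q ^ 4) k))
  let D : K → K := fun x => (1 - x ^ 2) * (1 - c * q ^ 4 * x ^ 2) * (1 - x ^ 2 / c) *
    ((1 - x / q) * (1 - x) ^ 2)
  let G : ℕ → K := fun k => T k * D (q ^ (2 * k)) / q ^ (2 * k)
  have hx2 : ∀ k, (q ^ 2) ^ k = q ^ (2 * k) := fun k => by ring
  have hx4 : ∀ k, (q ^ 4) ^ k = (q ^ (2 * k)) ^ 2 := fun k => by ring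
  have hA : ∀ k, (1 - c * q) * (1 - c * q ^ 3) * (1 - 1 / c) *
      quadTerm q (c * q ^ 4) q q (q ^ 2) k = T k * (1 - q * (q ^ (2 * k)) ^ 3) *
      ((1 - c * q * q ^ (2 * k)) * (1 - c * q ^ 3 * q ^ (2 * k)) *
        (1 - (q ^ (2 * k)) ^ 2 / c)) := by
    intro k
    have h1 := qPoch_shift (c * q) (q ^ 2) k
    have h2 := qPoch_shift (c * q ^ 3) (q ^ 2) k
    have h3 := qPoch_shift (1 / c) (q ^ 4) k
    rw [show c * q * q ^ 2 = c * q ^ 3 by ring, hx2] at h1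
    rw [show c * q ^ 3 * q ^ 2 = c * q ^ 5 by ring, hx2] at h2
    rw [show 1 / c * q ^ 4 = q ^ 4 / c by ring, hx4] at h3
    have n1 := qPoch_ne_zero hc4' k
    have n2 := qPoch_ne_zero hc4'' k
    have n3 := qPoch_ne_zero hc8 k
    rw [quadTerm_eq_cubicAux hq0, show c * q ^ 4 * q = c * q ^ 5 by ring,
      show c * q ^ 4 * q ^ 4 = c * q ^ 8 by ring,
      show q / (c * q ^ 4) = 1 / (q ^ 3 * c) by field_simp,
      show q ^ 4 / (c * q ^ 4) = 1 / c by field_simp]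
    have h4 : (1 - 1 / c) / qPoch (1 / c) (q ^ 4) k =
        (1 - (q ^ (2 * k)) ^ 2 / c) / qPoch (q ^ 4 / c) (q ^ 4) k := by
      rw [div_eq_div_iff n1 n2]
      linear_combination h3
    have h5 : (1 - c * q) * (1 - c * q ^ 3) * qPoch (c * q ^ 5) (q ^ 2) k =
        qPoch (c * q) (q ^ 2) k * ((1 - c * q * q ^ (2 * k)) * (1 - c * q ^ 3 * q ^ (2 * k))) := by
      linear_combination (1 - c * q) * h2 + (1 - c * q ^ 3 * q ^ (2 * k)) * h1
    calc _ = (1 - q * (q ^ (2 * k)) ^ 3) * cubicAux q k * qPoch (1 / (q ^ 3 * c)) (q ^ 2) k /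
          qPoch (c * q ^ 8) (q ^ 4) k *
          ((1 - c * q) * (1 - c * q ^ 3) * qPoch (c * q ^ 5) (q ^ 2) k) *
          ((1 - 1 / c) / qPoch (1 / c) (q ^ 4) k) := by
          simp only [div_eq_mul_inv, mul_inv]
          ring
      _ = _ := by
        rw [h5, h4]
        simp only [T, div_eq_mul_inv, mul_inv]
        ring
  have hB : ∀ k, (1 - 1 / (q ^ 3 * c)) * (1 - 1 / (q * c)) * (1 - c * q ^ 4) *
      quadTerm q c q q (q ^ 2) k = T k * (1 - q * (q ^ (2 * k)) ^ 3) *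
      ((1 - q ^ (2 * k) / (q ^ 3 * c)) * (1 - q ^ (2 * k) / (q * c)) *
        (1 - c * q ^ 4 * (q ^ (2 * k)) ^ 2)) := by
    intro k
    have h1 := qPoch_shift (1 / (q ^ 3 * c)) (q ^ 2) k
    have h2 := qPoch_shift (1 / (q * c)) (q ^ 2) k
    have h3 := qPoch_shift (c * q ^ 4) (q ^ 4) k
    rw [show 1 / (q ^ 3 * c) * q ^ 2 = 1 / (q * c) by field_simp, hx2] at h1
    rw [show 1 / (q * c) * q ^ 2 = q / c by field_simp, hx2] at h2
    rw [show c * q ^ 4 * q ^ 4 = c * q ^ 8 by ring, hx4] at h3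
    have n1 := qPoch_ne_zero hc4 k
    have n3 := qPoch_ne_zero hc8 k
    rw [quadTerm_eq_cubicAux hq0]
    have h4 : (1 - c * q ^ 4) / qPoch (c * q ^ 4) (q ^ 4) k =
        (1 - c * q ^ 4 * (q ^ (2 * k)) ^ 2) / qPoch (c * q ^ 8) (q ^ 4) k := by
      rw [div_eq_div_iff n1 n3]
      linear_combination h3
    have h5 : (1 - 1 / (q ^ 3 * c)) * (1 - 1 / (q * c)) * qPoch (q / c) (q ^ 2) k =
        qPoch (1 / (q ^ 3 * c)) (q ^ 2) k *
          ((1 - q ^ (2 * k) / (q ^ 3 * c)) * (1 - q ^ (2 * k) / (q * c))) := by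
      linear_combination (1 - 1 / (q ^ 3 * c)) * h2 + (1 - q ^ (2 * k) / (q * c)) * h1
    calc _ = (1 - q * (q ^ (2 * k)) ^ 3) * cubicAux q k * qPoch (c * q) (q ^ 2) k /
          qPoch (q ^ 4 / c) (q ^ 4) k *
          ((1 - 1 / (q ^ 3 * c)) * (1 - 1 / (q * c)) * qPoch (q / c) (q ^ 2) k) *
          ((1 - c * q ^ 4) / qPoch (c * q ^ 4) (q ^ 4) k) := by
          simp only [div_eq_mul_inv, mul_inv]
          ring
      _ = _ := by
        rw [h5, h4]
        simp only [T, div_eq_mul_inv, mul_inv]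
        ring
  have hTsucc : ∀ k, T (k + 1) * D (q ^ (2 * (k + 1))) = T k * (q ^ 2 *
      ((1 - q * q ^ (2 * k)) * (1 - c * q * q ^ (2 * k)) * (1 - q ^ (2 * k) / (q ^ 3 * c)) *
          ((1 - q ^ 2 * (q ^ (2 * k)) ^ 2) * (1 - q * (q ^ (2 * k)) ^ 2) ^ 2))) := by
    intro k
    have h1 := cubicAux_succ hq k
    have h2 := hc8 k
    have h3 := hc4'' k
    have hD : D (q ^ (2 * (k + 1))) = (1 - q ^ 4 * (q ^ (2 * k)) ^ 2) * ((1 - q * q ^ (2 * k)) *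
        (1 - q ^ 2 * q ^ (2 * k)) ^ 2) * ((1 - c * q ^ 8 * (q ^ (2 * k)) ^ 2) *
        (1 - q ^ 4 / c * (q ^ (2 * k)) ^ 2)) := by
      simp only [D]
      rw [show q ^ (2 * (k + 1)) = q * (q * q ^ (2 * k)) by ring, mul_div_cancel_left₀ _ hq0]
      ring
    rw [hx4] at h2 h3
    rw [hD]
    simp only [T, qPoch_succ, hx2, hx4]
    generalize (1 - c * q ^ 8 * (q ^ (2 * k)) ^ 2) = a1 at *
    generalize (1 - q ^ 4 / c * (q ^ (2 * k)) ^ 2) = a2 at *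
    have key : a1⁻¹ * a1 * (a2⁻¹ * a2) = 1 := by simp [h2, h3]
    simp only [div_eq_mul_inv, mul_inv]
    calc _ = (cubicAux q (k + 1) * ((1 - q ^ 4 * (q ^ (2 * k)) ^ 2) * ((1 - q * q ^ (2 * k)) *
        (1 - q ^ 2 * q ^ (2 * k)) ^ 2))) * (qPoch (c * q) (q ^ 2) k *
          (1 - c * q * q ^ (2 * k)) * (qPoch (1 * ((q ^ 3)⁻¹ * c⁻¹)) (q ^ 2) k *
          (1 - 1 * ((q ^ 3)⁻¹ * c⁻¹) * q ^ (2 * k))) *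
          ((qPoch (c * q ^ 8) (q ^ 4) k)⁻¹ * (qPoch (q ^ 4 * c⁻¹) (q ^ 4) k)⁻¹)) *
          (a1⁻¹ * a1 * (a2⁻¹ * a2)) := by ring
      _ = _ := by
        rw [h1, key]
        ring
  have htel : ∑ k ∈ Finset.range L, (G (k + 1) - G k) = 0 := by
    rw [Finset.sum_range_sub]
    have hT : T L = 0 := by simp only [T, hL, mul_zero, zero_div]
    have h0 : D (q ^ (2 * 0)) = 0 := by simp [D]
    simp only [G, hT, h0]
    simp
  have hk : ∀ k, (1 - c * q ^ 2) * q ^ 2 *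
        (-((1 - c * q ^ 3) ^ 2 * ((1 - c * q) * (1 - c * q ^ 3) * (1 - 1 / c)) *
          quadTerm q (c * q ^ 4) q q (q ^ 2) k)) -
      (1 - c * q ^ 2) * q ^ 2 * ((c * q ^ 4 * (1 - c * q) ^ 2 *
        ((1 - 1 / (q ^ 3 * c)) * (1 - 1 / (q * c)) * (1 - c * q ^ 4))) *
          quadTerm q c q q (q ^ 2) k) =
      q ^ 2 * ((1 - c ^ 2 * q ^ 4) * (c * q ^ 3)) * (G (k + 1) - G k) := by
    intro k
    have hx : q ^ (2 * k) ≠ 0 := pow_ne_zero _ hq0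
    have hcert := cubic_certificate (x := q ^ (2 * k)) hc hq0
    have hG : G (k + 1) = T k *
        ((1 - q * q ^ (2 * k)) * (1 - c * q * q ^ (2 * k)) * (1 - q ^ (2 * k) / (q ^ 3 * c)) *
          ((1 - q ^ 2 * (q ^ (2 * k)) ^ 2) * (1 - q * (q ^ (2 * k)) ^ 2) ^ 2)) /
        q ^ (2 * k) := by
      simp only [G]
      rw [hTsucc, show q ^ (2 * (k + 1)) = q ^ 2 * q ^ (2 * k) by ring, mul_left_comm,
        mul_div_mul_left _ _ (pow_ne_zero 2 hq0)]
    have hfac : ∀ T N D X Y : K,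
        q ^ 2 * Y * (T * N / X - T * D / X) = q ^ 2 * T * (Y * (N - D)) / X := by
      intros
      ring
    rw [hG, show G k = T k * ((1 - (q ^ (2 * k)) ^ 2) * (1 - c * q ^ 4 * (q ^ (2 * k)) ^ 2) *
      (1 - (q ^ (2 * k)) ^ 2 / c) * ((1 - q ^ (2 * k) / q) * (1 - q ^ (2 * k)) ^ 2)) /
        q ^ (2 * k) from rfl, hfac, hcert, eq_div_iff hx]
    linear_combination (-(1 - c * q ^ 2) * q ^ 2 * (1 - c * q ^ 3) ^ 2 * q ^ (2 * k)) * hA k -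
      ((1 - c * q ^ 2) * q ^ 2 * (c * q ^ 4 * (1 - c * q) ^ 2) * q ^ (2 * k)) * hB k
  have hsum := Finset.sum_congr (rfl : Finset.range L = Finset.range L) fun k _ => hk k
  rw [← Finset.mul_sum, htel, mul_zero, Finset.sum_sub_distrib] at hsum
  simp only [← Finset.mul_sum, Finset.sum_neg_distrib] at hsum
  have hne : (1 - c * q ^ 2) * q ^ 2 ≠ 0 := mul_ne_zero hc2 (pow_ne_zero _ hq0)
  have := mul_left_cancel₀ hne (sub_eq_zero.1 hsum)
  linear_combination -this

/-- For `N = 4 * m + 3`, the series with parameters `c = q ^ N` and `q, q, q ^ 2` sums to zero. -/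
lemma sum_quadTerm_cubic_eq_zero {q : K} (hq0 : q ≠ 0) (hq : ∀ j : ℕ, 0 < j → q ^ j ≠ 1)
    {L : ℕ} (m : ℕ) (hL : 2 * m + 1 < L) :
    ∑ k ∈ Finset.range L, quadTerm q (q ^ (4 * m + 3)) q q (q ^ 2) k = 0 := by
  have hne : ∀ {i j : ℕ}, i ≠ j → q ^ i ≠ q ^ j := by
    have aux : ∀ {i j : ℕ}, i < j → q ^ i ≠ q ^ j := fun {i j} hij h => by
      refine hq (j - i) (by omega) ?_
      have : q ^ i * q ^ (j - i) = q ^ i * 1 := by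
        rw [← pow_add, Nat.add_sub_cancel' hij.le, mul_one, h]
      exact mul_left_cancel₀ (pow_ne_zero _ hq0) this
    intro i j hij
    rcases lt_or_gt_of_ne hij with h | h
    · exact aux h
    · exact (aux h).symm
  have hone : ∀ {j : ℕ}, 0 < j → 1 - q ^ j ≠ 0 := fun hj => sub_ne_zero.2 (hq _ hj).symm
  induction m with
  | zero =>
    have hz : ∀ k, 2 ≤ k → quadTerm q (q ^ (4 * 0 + 3)) q q (q ^ 2) k = 0 := fun k hk => by
      have : qPoch (q / q ^ (4 * 0 + 3)) (q ^ 2) k = 0 :=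
        qPoch_eq_zero (i := 1) (by omega) (by field_simp)
      simp [quadTerm, this]
    rw [← Finset.sum_subset (Finset.range_subset_range.2 (show 2 ≤ L by omega)) fun k _ hk =>
      hz k (by rw [Finset.mem_range, not_lt] at hk; exact hk)]
    have e1 : q ^ 3 / q = q ^ 2 := by field_simp
    have e2 : q ^ 3 / q ^ 2 = q := by field_simp
    have e3 : q ^ 4 / q ^ 3 = q := by field_simp
    have e4 : q / q ^ 3 = 1 / q ^ 2 := by field_simp
    have h1 : 1 - q ≠ 0 := by simpa using hone (j := 1) (by omega)
    have h2 := hone (j := 2) (by omega)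
    have h4 := hone (j := 4) (by omega)
    have h7 := hone (j := 7) (by omega)
    simp only [quadTerm, Finset.sum_range_succ, Finset.sum_range_zero, qPoch,
      Finset.prod_range_succ, Finset.prod_range_zero, e1, e2, Nat.mul_zero, Nat.zero_add, e3, e4]
    norm_num
    rw [show q ^ 3 * q = q ^ 4 by ring, show q ^ 3 * q ^ 4 = q ^ 7 by ring]
    field_simp
    ring
  | succ m ih =>
    have h := quadTerm_contiguous_cubic (q := q) (c := q ^ (4 * m + 3)) (L := L) hq0 hq
      (pow_ne_zero _ hq0) (by rw [← pow_add]; exact hone (by omega))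
      (fun i => by
        rw [← pow_mul, ← pow_add, ← pow_add]
        exact hone (by omega))
      (fun i => by
        rw [← pow_mul, one_div_mul_eq_div, sub_ne_zero, ne_comm, Ne,
          div_eq_one_iff_eq (pow_ne_zero _ hq0)]
        exact hne (by omega))
      (qPoch_eq_zero (i := 2 * m + 3) (by omega) (by field_simp; ring))
    rw [ih (by omega), mul_zero] at h
    rw [show 4 * (m + 1) + 3 = 4 * m + 3 + 4 by ring, pow_add q (4 * m + 3) 4]
    refine (mul_eq_zero.1 h).resolve_left ?_
    have h1 : 1 - 1 / q ^ (4 * m + 3) ≠ 0 := by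
      rw [sub_ne_zero, ne_comm, Ne, one_div, inv_eq_one]
      exact hq _ (by omega)
    have h2 : 1 - q ^ (4 * m + 3) * q ^ 3 ≠ 0 := by rw [← pow_add]; exact hone (by omega)
    have h3 : 1 - q ^ (4 * m + 3) * q ≠ 0 := by rw [← pow_succ]; exact hone (by omega)
    exact mul_ne_zero (pow_ne_zero _ h2) (mul_ne_zero (mul_ne_zero h3 h2) h1)

/-- Terminating case of the quadratic summation, with denominators cleared. -/
lemma prod_mul_sum_quadTerm {q c f g : K} (hq0 : q ≠ 0) (hc : c ≠ 0) (hg : g ≠ 0)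
    (hfg : f * g = q ^ 4) (hq : ∀ j : ℕ, 0 < j → q ^ j ≠ 1)
    (hc4 : ∀ i : ℕ, 1 - c * q ^ 4 * (q ^ 4) ^ i ≠ 0)
    (hc4' : ∀ i : ℕ, 1 - q ^ 4 / c * (q ^ 4) ^ i ≠ 0)
    (hfQ : ∀ i : ℕ, 1 - q ^ 3 / f * (q ^ 2) ^ i ≠ 0)
    (hg1 : ∀ j : ℕ, 1 - g * q ^ (4 * j) ≠ 0)
    (hgQ : ∀ i j : ℕ, 1 - 1 / (q * (g * q ^ (4 * j))) * (q ^ 2) ^ i ≠ 0)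
    (m L : ℕ) (hL : m < L) :
    (∏ j ∈ Finset.range m, ((1 - c * (1 / q ^ (4 * (j + 1)))) * (1 - 1 / q ^ (4 * (j + 1)) / c) *
        ((g * q ^ (4 * j) - 1 / q) * (g * q ^ (4 * j) - q)))) *
      ∑ k ∈ Finset.range L, quadTerm q c (1 / q ^ (4 * m)) f (g * q ^ (4 * m)) k =
    (∏ j ∈ Finset.range m, ((1 - c * (g * q ^ (4 * j))) * (1 - g * q ^ (4 * j) / c) *
        ((1 / q ^ (4 * (j + 1)) - 1 / q) * (1 / q ^ (4 * (j + 1)) - q)))) * (1 - q) := by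
  induction m with
  | zero =>
    rw [Finset.sum_eq_single_of_mem 0 (Finset.mem_range.2 hL)]
    · simp [quadTerm, qPoch_zero]
    · intro k _ hk
      have : qPoch (1 / q ^ (4 * 0)) (q ^ 4) k = 0 :=
        qPoch_eq_zero (Nat.pos_of_ne_zero hk) (by simp)
      rw [quadTerm, this]
      simp
  | succ m ih =>
    have hone : ∀ {j : ℕ}, 0 < j → 1 - q ^ j ≠ 0 := fun hj => sub_ne_zero.2 (hq _ hj).symm
    have h := quadTerm_contiguous (q := q) (c := c) (e := 1 / q ^ (4 * (m + 1))) (f := f)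
      (g := g * q ^ (4 * m)) (L := L) hq0 hc (one_div_ne_zero (pow_ne_zero _ hq0))
      (mul_ne_zero hg (pow_ne_zero _ hq0))
      (by
        rw [show 1 / q ^ (4 * (m + 1)) * f * (g * q ^ (4 * m)) =
          f * g * q ^ (4 * m) / q ^ (4 * (m + 1)) by ring, hfg, ← pow_add,
          show 4 + 4 * m = 4 * (m + 1) by ring, div_self (pow_ne_zero _ hq0)])
      (by
        rw [sub_ne_zero, ne_comm, Ne, one_div, inv_eq_one]
        exact hq _ (by omega))
      (hg1 m)
      (fun i => by
        rw [← pow_mul, ← pow_add]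
        exact hone (by omega))
      hc4 hc4'
      (fun i => by
        rw [show 1 / (q * (1 / q ^ (4 * (m + 1)))) * (q ^ 2) ^ i = q ^ (4 * m + 3 + 2 * i) by
          rw [show q ^ (4 * (m + 1)) = q * q ^ (4 * m + 3) by ring]; field_simp; ring]
        exact hone (by omega))
      hfQ (fun i => hgQ i m)
      (qPoch_eq_zero hL (by
        rw [← pow_mul, one_div, inv_mul_cancel₀ (pow_ne_zero _ hq0)]))
    rw [show g * q ^ (4 * m) * q ^ 4 = g * q ^ (4 * (m + 1)) by ring,
      show 1 / q ^ (4 * (m + 1)) * q ^ 4 = 1 / q ^ (4 * m) by field_simp; ring] at h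
    rw [Finset.prod_range_succ, Finset.prod_range_succ, mul_assoc, h]
    have ih := ih (by omega)
    linear_combination ((1 - c * (g * q ^ (4 * m))) * (1 - g * q ^ (4 * m) / c) *
      ((1 / q ^ (4 * (m + 1)) - 1 / q) * (1 / q ^ (4 * (m + 1)) - q))) * ih

lemma sum_quadTerm_two {q c : K} (hq0 : q ≠ 0) (hc : c ≠ 0) (hq : ∀ j : ℕ, 0 < j → q ^ j ≠ 1)
    (hc4 : ∀ i : ℕ, 1 - c * q ^ 4 * (q ^ 4) ^ i ≠ 0)
    (hc4' : ∀ i : ℕ, 1 - q ^ 4 / c * (q ^ 4) ^ i ≠ 0) {m L : ℕ} (hL : m < L) :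
    ∑ k ∈ Finset.range L, quadTerm q c (q ^ (4 * m + 1) * q) (q / q ^ (4 * m + 1)) (q ^ 2) k =
      (1 - q ^ (4 * m + 1)) * (qPoch (c * q ^ 2) (q ^ 4) m * qPoch (q ^ 2 / c) (q ^ 4) m /
        (qPoch (c * q ^ 4) (q ^ 4) m * qPoch (q ^ 4 / c) (q ^ 4) m)) := by
  have hone : ∀ {j : ℕ}, 0 < j → 1 - q ^ j ≠ 0 := fun hj => sub_ne_zero.2 (hq _ hj).symm
  have hne : ∀ {i j : ℕ}, i < j → q ^ j - q ^ i ≠ 0 := fun {i j} hij => by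
    obtain ⟨k, rfl⟩ := Nat.exists_eq_add_of_lt hij
    rw [show q ^ (i + k + 1) - q ^ i = -(q ^ i * (1 - q ^ (k + 1))) by ring]
    exact neg_ne_zero.2 (mul_ne_zero (pow_ne_zero _ hq0) (hone (by omega)))
  have h := prod_mul_sum_quadTerm (q := q) (c := c) (f := q ^ 2) (g := q ^ 2) hq0 hc
    (pow_ne_zero _ hq0) (by ring) hq hc4 hc4'
    (fun i => by
      rw [show q ^ 3 / q ^ 2 * (q ^ 2) ^ i = q ^ (2 * i + 1) by field_simp; ring]
      exact hone (by omega))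
    (fun j => by
      rw [← pow_add]
      exact hone (by omega))
    (fun i j => by
      rw [← pow_add, ← pow_succ', ← pow_mul, one_div_mul_eq_div, one_sub_div (pow_ne_zero _ hq0)]
      refine div_ne_zero ?_ (pow_ne_zero _ hq0)
      rcases lt_or_gt_of_ne (show 2 * i ≠ 2 + 4 * j + 1 by omega) with h | h
      · exact hne h
      · rw [← neg_sub]
        exact neg_ne_zero.2 (hne h)) m L hL
  have hE : ∀ j : ℕ, (q ^ 4) ^ j = q ^ (4 * j) := fun j => (pow_mul q 4 j).symm
  have hP : ∏ j ∈ Finset.range m, ((1 - c * (1 / q ^ (4 * (j + 1)))) *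
      (1 - 1 / q ^ (4 * (j + 1)) / c) *
        ((q ^ 2 * q ^ (4 * j) - 1 / q) * (q ^ 2 * q ^ (4 * j) - q))) ≠ 0 := by
    refine Finset.prod_ne_zero_iff.2 fun j _ => mul_ne_zero ?_ (mul_ne_zero ?_ ?_)
    · rw [show (1 - c * (1 / q ^ (4 * (j + 1)))) * (1 - 1 / q ^ (4 * (j + 1)) / c) =
        (1 - c * q ^ 4 * (q ^ 4) ^ j) * (1 - q ^ 4 / c * (q ^ 4) ^ j) / (q ^ (4 * (j + 1))) ^ 2 by
          rw [hE, show 4 * (j + 1) = 4 + 4 * j by ring, pow_add]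
          field_simp
          ring]
      exact div_ne_zero (mul_ne_zero (hc4 j) (hc4' j)) (pow_ne_zero _ (pow_ne_zero _ hq0))
    · rw [show q ^ 2 * q ^ (4 * j) - 1 / q = -(1 - q ^ (4 * j + 3)) / q by field_simp; ring]
      exact div_ne_zero (neg_ne_zero.2 (hone (by omega))) hq0
    · rw [← pow_add]
      simpa using hne (show 1 < 2 + 4 * j by omega)
  have hN : ∀ m, (∏ j ∈ Finset.range m, ((1 - c * (q ^ 2 * q ^ (4 * j))) *
      (1 - q ^ 2 * q ^ (4 * j) / c) *
        ((1 / q ^ (4 * (j + 1)) - 1 / q) * (1 / q ^ (4 * (j + 1)) - q)))) * (1 - q) *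
        (qPoch (c * q ^ 4) (q ^ 4) m * qPoch (q ^ 4 / c) (q ^ 4) m) =
      (∏ j ∈ Finset.range m, ((1 - c * (1 / q ^ (4 * (j + 1)))) * (1 - 1 / q ^ (4 * (j + 1)) / c) *
        ((q ^ 2 * q ^ (4 * j) - 1 / q) * (q ^ 2 * q ^ (4 * j) - q)))) *
      ((1 - q ^ (4 * m + 1)) * (qPoch (c * q ^ 2) (q ^ 4) m * qPoch (q ^ 2 / c) (q ^ 4) m)) := by
    intro m
    induction m with
    | zero => simp [qPoch_zero]
    | succ m ih =>
      have hfac : ((1 - c * (q ^ 2 * q ^ (4 * m))) * (1 - q ^ 2 * q ^ (4 * m) / c) *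
          ((1 / q ^ (4 * (m + 1)) - 1 / q) * (1 / q ^ (4 * (m + 1)) - q))) *
          ((1 - c * q ^ 4 * (q ^ 4) ^ m) * (1 - q ^ 4 / c * (q ^ 4) ^ m)) *
          (1 - q ^ (4 * m + 1)) =
          ((1 - c * (1 / q ^ (4 * (m + 1)))) * (1 - 1 / q ^ (4 * (m + 1)) / c) *
          ((q ^ 2 * q ^ (4 * m) - 1 / q) * (q ^ 2 * q ^ (4 * m) - q))) *
          ((1 - q ^ (4 * (m + 1) + 1)) *
            ((1 - c * q ^ 2 * (q ^ 4) ^ m) * (1 - q ^ 2 / c * (q ^ 4) ^ m))) := by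
        rw [hE, show 4 * (m + 1) + 1 = 4 * m + 5 by ring, show 4 * (m + 1) = 4 * m + 4 by ring]
        simp only [pow_add q (4 * m)]
        have := pow_ne_zero (4 * m) hq0
        generalize q ^ (4 * m) = x at *
        field_simp
        ring
      rw [Finset.prod_range_succ, Finset.prod_range_succ]
      simp only [qPoch_succ]
      generalize (1 - c * (q ^ 2 * q ^ (4 * m))) * (1 - q ^ 2 * q ^ (4 * m) / c) *
          ((1 / q ^ (4 * (m + 1)) - 1 / q) * (1 / q ^ (4 * (m + 1)) - q)) = B1 at *
      generalize (1 - c * (1 / q ^ (4 * (m + 1)))) * (1 - 1 / q ^ (4 * (m + 1)) / c) *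
          ((q ^ 2 * q ^ (4 * m) - 1 / q) * (q ^ 2 * q ^ (4 * m) - q)) = B2 at *
      linear_combination (B1 * ((1 - c * q ^ 4 * (q ^ 4) ^ m) * (1 - q ^ 4 / c * (q ^ 4) ^ m))) *
        ih + ((∏ j ∈ Finset.range m, ((1 - c * (1 / q ^ (4 * (j + 1)))) *
          (1 - 1 / q ^ (4 * (j + 1)) / c) *
          ((q ^ 2 * q ^ (4 * j) - 1 / q) * (q ^ 2 * q ^ (4 * j) - q)))) *
          (qPoch (c * q ^ 2) (q ^ 4) m * qPoch (q ^ 2 / c) (q ^ 4) m)) * hfac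
  have hD : qPoch (c * q ^ 4) (q ^ 4) m * qPoch (q ^ 4 / c) (q ^ 4) m ≠ 0 :=
    mul_ne_zero (qPoch_ne_zero hc4 m) (qPoch_ne_zero hc4' m)
  have hterm : ∀ k, quadTerm q c (q ^ (4 * m + 1) * q) (q / q ^ (4 * m + 1)) (q ^ 2) k =
      quadTerm q c (1 / q ^ (4 * m)) (q ^ 2) (q ^ 2 * q ^ (4 * m)) k := fun k => by
    rw [show q ^ (4 * m + 1) * q = q ^ 2 * q ^ (4 * m) by ring,
      show q / q ^ (4 * m + 1) = 1 / q ^ (4 * m) by rw [pow_succ]; field_simp]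
    simp only [quadTerm]
    ring
  refine mul_left_cancel₀ hP ?_
  rw [Finset.sum_congr rfl fun k _ => hterm k, h, mul_div_assoc', mul_div_assoc', eq_div_iff hD]
  exact hN m

end QuadraticSummation

section Complex

open Filter Topology

/-- The points of the open unit disc that are transcendental over `ℚ`. -/
def transcendentalDisc : Set ℂ := {q | ‖q‖ < 1 ∧ Transcendental ℚ q}

lemma transcendentalDisc_nhdsWithin_neBot {ζ : ℂ} (hζ : ‖ζ‖ = 1) :
    (𝓝[transcendentalDisc] ζ).NeBot := by
  rw [← mem_closure_iff_nhdsWithin_neBot]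
  have hdense : Dense {q : ℂ | Transcendental ℚ q} := by
    have : {q : ℂ | IsAlgebraic ℚ q}.Countable := Algebraic.countable ℚ ℂ
    exact this.dense_compl ℝ
  have h := hdense.open_subset_closure_inter (Metric.isOpen_ball (x := (0 : ℂ)) (ε := 1))
  have h1 : ζ ∈ closure (Metric.ball (0 : ℂ) 1) := by
    rw [closure_ball _ one_ne_zero]
    simp [hζ]
  have h2 := closure_mono h h1
  rw [closure_closure] at h2
  refine closure_mono ?_ h2
  rintro q ⟨hq1, hq2⟩
  exact ⟨by simpa using hq1, hq2⟩

lemma ne_zero_of_mem_transcendentalDisc {q : ℂ} (hq : q ∈ transcendentalDisc) : q ≠ 0 := fun h =>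
  hq.2 (h ▸ isAlgebraic_zero)

lemma pow_ne_one_of_norm_lt_one {q : ℂ} (hq : ‖q‖ < 1) {j : ℕ} (hj : 0 < j) : q ^ j ≠ 1 :=
  fun h => by
    have h1 : ‖q‖ ^ j < 1 := pow_lt_one₀ (norm_nonneg _) hq hj.ne'
    rw [← norm_pow, h] at h1
    simp at h1

lemma one_sub_ne_zero_of_norm_ne_one {z : ℂ} (hz : ‖z‖ ≠ 1) : 1 - z ≠ 0 := fun h => by
  rw [← sub_eq_zero.1 h] at hz
  simp at hz

lemma one_sub_mul_pow_ne_zero {q u : ℂ} (hq : ‖q‖ < 1) (hu : ‖u‖ = 1) {j : ℕ} (hj : 0 < j) :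
    1 - u * q ^ j ≠ 0 :=
  one_sub_ne_zero_of_norm_ne_one (by
    rw [norm_mul, norm_pow, hu, one_mul]
    exact (pow_lt_one₀ (norm_nonneg _) hq hj.ne').ne)

@[fun_prop]
lemma continuousAt_qPoch {f g : ℂ → ℂ} {z : ℂ} (hf : ContinuousAt f z) (hg : ContinuousAt g z)
    (k : ℕ) : ContinuousAt (fun t => qPoch (f t) (g t) k) z := by
  unfold qPoch
  fun_prop

/-- The factor of the summand that does not depend on the two deformation parameters. -/
noncomputable def weight (q : ℂ) (k : ℕ) : ℂ :=
  (1 - q ^ (6 * k + 1)) * (qPoch (q ^ 2) (q ^ 4) k / qPoch (q ^ 4) (q ^ 4) k) * q ^ (2 * k)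

/-- The factor of the summand that depends on the deformation parameter `c`. -/
noncomputable def cFactor (q c : ℂ) (k : ℕ) : ℂ :=
  qPoch (c * q) (q ^ 2) k * qPoch (q / c) (q ^ 2) k /
    (qPoch (c * q ^ 4) (q ^ 4) k * qPoch (q ^ 4 / c) (q ^ 4) k)

/-- The factor of the summand that depends on the deformation parameter `a`. -/
noncomputable def aFactor (q a : ℂ) (k : ℕ) : ℂ :=
  qPoch (a * q) (q ^ 4) k * qPoch (q / a) (q ^ 4) k /
    (qPoch (a * q ^ 2) (q ^ 2) k * qPoch (q ^ 2 / a) (q ^ 2) k)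

lemma quadTerm_eq_weight_mul {q a : ℂ} (hq0 : q ≠ 0) (ha : a ≠ 0) (c : ℂ) {k : ℕ}
    (hk : qPoch q (q ^ 2) k ≠ 0) :
    quadTerm q c (a * q) (q / a) (q ^ 2) k = weight q k * cFactor q c k * aFactor q a k := by
  rw [quadTerm, weight, cFactor, aFactor, show q ^ 3 / q ^ 2 = q by field_simp,
    show q ^ 3 / (a * q) = q ^ 2 / a by field_simp, show q ^ 3 / (q / a) = a * q ^ 2 by field_simp]
  have key : qPoch q (q ^ 2) k * (qPoch q (q ^ 2) k)⁻¹ = 1 := mul_inv_cancel₀ hk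
  simp only [div_eq_mul_inv, mul_inv]
  generalize (qPoch q (q ^ 2) k)⁻¹ = y at *
  linear_combination ((1 - q ^ (6 * k + 1)) *
    (qPoch (q ^ 2) (q ^ 4) k * (qPoch (q ^ 4) (q ^ 4) k)⁻¹) * q ^ (2 * k) *
    (qPoch (c * q) (q ^ 2) k * qPoch (q * c⁻¹) (q ^ 2) k *
      ((qPoch (c * q ^ 4) (q ^ 4) k)⁻¹ * (qPoch (q ^ 4 * c⁻¹) (q ^ 4) k)⁻¹)) *
    (qPoch (a * q) (q ^ 4) k * qPoch (q * a⁻¹) (q ^ 4) k *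
      ((qPoch (a * q ^ 2) (q ^ 2) k)⁻¹ * (qPoch (q ^ 2 * a⁻¹) (q ^ 2) k)⁻¹))) * key

lemma sum_weight_eq_zero {ζ a c : ℂ} {d m : ℕ} (hd : d = 2 * m + 1) (hm : 0 < m)
    (hζ : IsPrimitiveRoot ζ d) (ha : ‖a‖ = 1) (hc : ‖c‖ = 1) (had : a ^ d ≠ 1) (hcd : c ^ d ≠ 1) :
    ∑ k ∈ Finset.range d, weight ζ k * cFactor ζ c k * aFactor ζ a k = 0 := by
  have hζ0 : ζ ≠ 0 := hζ.ne_zero (by omega)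
  have hζn : ‖ζ‖ = 1 := hζ.norm'_eq_one (by omega)
  have ha0 : a ≠ 0 := norm_ne_zero_iff.1 (by rw [ha]; exact one_ne_zero)
  have hc0 : c ≠ 0 := norm_ne_zero_iff.1 (by rw [hc]; exact one_ne_zero)
  have hodd : ∀ {j : ℕ}, ¬ d ∣ j → ζ ^ j ≠ 1 := fun hj h => hj (hζ.dvd_of_pow_eq_one _ h)
  have hroot : ∀ {u : ℂ}, u ^ d ≠ 1 → ∀ j : ℕ, 1 - u * ζ ^ j ≠ 0 := fun {u} hu j h => by
    apply hu
    have : (u * ζ ^ j) ^ d = 1 := by rw [← sub_eq_zero.1 h, one_pow]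
    rwa [mul_pow, ← pow_mul, mul_comm j, pow_mul, hζ.pow_eq_one, one_pow, mul_one] at this
  have hroot' : ∀ {u : ℂ}, u ^ d ≠ 1 → ∀ j : ℕ, 1 - ζ ^ j / u ≠ 0 := fun {u} hu j => by
    rw [div_eq_inv_mul]
    exact hroot (by rwa [inv_pow, Ne, inv_eq_one]) j
  let S : ℂ → ℂ := fun q => ∑ k ∈ Finset.range (m + 1),
    quadTerm q c (1 / q ^ (4 * m)) (a * q) (q ^ 3 / a * q ^ (4 * m)) k
  let P : ℂ → ℂ := fun q => ∏ j ∈ Finset.range m, ((1 - c * (1 / q ^ (4 * (j + 1)))) *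
    (1 - 1 / q ^ (4 * (j + 1)) / c) *
        ((q ^ 3 / a * q ^ (4 * j) - 1 / q) * (q ^ 3 / a * q ^ (4 * j) - q)))
  let N : ℂ → ℂ := fun q => (∏ j ∈ Finset.range m, ((1 - c * (q ^ 3 / a * q ^ (4 * j))) *
    (1 - q ^ 3 / a * q ^ (4 * j) / c) *
        ((1 / q ^ (4 * (j + 1)) - 1 / q) * (1 / q ^ (4 * (j + 1)) - q)))) * (1 - q)
  have hPS : ∀ q ∈ transcendentalDisc, P q * S q = N q := by
    intro q hq
    have hq0 := ne_zero_of_mem_transcendentalDisc hq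
    have hq1 := hq.1
    have hinv : ∀ {u : ℂ}, ‖u‖ = 1 → ‖u⁻¹‖ = 1 := fun hu => by rw [norm_inv, hu, inv_one]
    refine prod_mul_sum_quadTerm hq0 hc0 (div_ne_zero (pow_ne_zero _ hq0) ha0)
      (by field_simp) (fun j hj => pow_ne_one_of_norm_lt_one hq1 hj) (fun i => ?_) (fun i => ?_)
      (fun i => ?_) (fun i => ?_) (fun i j => ?_) m _ (Nat.lt_succ_self m)
    · rw [← pow_mul, mul_assoc, ← pow_add]
      exact one_sub_mul_pow_ne_zero hq1 hc (by omega)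
    · rw [← pow_mul, div_eq_inv_mul, mul_assoc, ← pow_add]
      exact one_sub_mul_pow_ne_zero hq1 (hinv hc) (by omega)
    · rw [show q ^ 3 / (a * q) * (q ^ 2) ^ i = a⁻¹ * q ^ (2 + 2 * i) by
        rw [pow_add, pow_mul]; field_simp]
      exact one_sub_mul_pow_ne_zero hq1 (hinv ha) (by omega)
    · rw [div_eq_inv_mul, mul_assoc, ← pow_add]
      exact one_sub_mul_pow_ne_zero hq1 (hinv ha) (by omega)
    · rw [show 1 / (q * (q ^ 3 / a * q ^ (4 * j))) * (q ^ 2) ^ i =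
        a * q ^ (2 * i) / q ^ (4 + 4 * j) by rw [pow_add, pow_mul q 2]; field_simp]
      rw [one_sub_div (pow_ne_zero _ hq0)]
      refine div_ne_zero ?_ (pow_ne_zero _ hq0)
      rcases lt_trichotomy (2 * i) (4 + 4 * j) with h | h | h
      · obtain ⟨r, hr⟩ := Nat.exists_eq_add_of_lt h
        rw [hr, show q ^ (2 * i + r + 1) - a * q ^ (2 * i) =
          -(a * q ^ (2 * i) * (1 - a⁻¹ * q ^ (r + 1))) by field_simp; ring]
        exact neg_ne_zero.2 (mul_ne_zero (mul_ne_zero ha0 (pow_ne_zero _ hq0))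
          (one_sub_mul_pow_ne_zero hq1 (hinv ha) (by omega)))
      · rw [h, ← one_sub_mul]
        refine mul_ne_zero (sub_ne_zero.2 fun h' => had ?_) (pow_ne_zero _ hq0)
        rw [← h', one_pow]
      · obtain ⟨r, hr⟩ := Nat.exists_eq_add_of_lt h
        rw [hr, show q ^ (4 + 4 * j) - a * q ^ (4 + 4 * j + r + 1) =
          q ^ (4 + 4 * j) * (1 - a * q ^ (r + 1)) by ring]
        exact mul_ne_zero (pow_ne_zero _ hq0) (one_sub_mul_pow_ne_zero hq1 ha (by omega))
  have hζd : ζ ^ (2 * m + 1) = 1 := hd ▸ hζ.pow_eq_one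
  have hζ4 : 1 / ζ ^ (4 * m) = ζ ^ 2 := by
    rw [div_eq_iff (pow_ne_zero _ hζ0), show ζ ^ 2 * ζ ^ (4 * m) = (ζ ^ (2 * m + 1)) ^ 2 by ring,
      hζd, one_pow]
  have hζ3 : ζ ^ 3 / a * ζ ^ (4 * m) = ζ / a := by
    rw [show ζ ^ 3 / a * ζ ^ (4 * m) = (ζ ^ (2 * m + 1)) ^ 2 * (ζ / a) by ring, hζd, one_pow,
      one_mul]
  have hScont : ContinuousAt S ζ := by
    refine tendsto_finsetSum _ fun k hk => ?_
    have hk : k < m + 1 := Finset.mem_range.1 hk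
    have hden : qPoch (ζ ^ 4) (ζ ^ 4) k * qPoch (c * ζ ^ 4) (ζ ^ 4) k *
      qPoch (ζ ^ 4 / c) (ζ ^ 4) k *
      (qPoch (ζ ^ 3 / (1 / ζ ^ (4 * m))) (ζ ^ 2) k * qPoch (ζ ^ 3 / (a * ζ)) (ζ ^ 2) k *
        qPoch (ζ ^ 3 / (ζ ^ 3 / a * ζ ^ (4 * m))) (ζ ^ 2) k) ≠ 0 := by
      rw [hζ4, hζ3]
      refine mul_ne_zero (mul_ne_zero (mul_ne_zero ?_ ?_) ?_) (mul_ne_zero (mul_ne_zero ?_ ?_) ?_)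
      · refine Finset.prod_ne_zero_iff.2 fun i hi => ?_
        have hi := Finset.mem_range.1 hi
        rw [← pow_mul, ← pow_add, show 4 + 4 * i = 2 * (2 * (i + 1)) by ring]
        refine sub_ne_zero.2 (hodd fun h => ?_).symm
        have h2 : d.Coprime 2 := by rw [hd]; simp
        have := Nat.le_of_dvd (by omega) (h2.dvd_of_dvd_mul_left (h2.dvd_of_dvd_mul_left h))
        omega
      · refine Finset.prod_ne_zero_iff.2 fun i hi => ?_
        rw [← pow_mul, mul_assoc, ← pow_add]
        exact hroot hcd _
      · refine Finset.prod_ne_zero_iff.2 fun i hi => ?_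
        rw [← pow_mul, div_mul_eq_mul_div, ← pow_add]
        exact hroot' hcd _
      · refine Finset.prod_ne_zero_iff.2 fun i hi => ?_
        have hi := Finset.mem_range.1 hi
        rw [show ζ ^ 3 / ζ ^ 2 * (ζ ^ 2) ^ i = ζ ^ (2 * i + 1) by field_simp; ring]
        refine sub_ne_zero.2 (hodd fun h => ?_).symm
        have := Nat.le_of_dvd (by omega) h
        omega
      · refine Finset.prod_ne_zero_iff.2 fun i hi => ?_
        rw [show ζ ^ 3 / (a * ζ) * (ζ ^ 2) ^ i = ζ ^ (2 + 2 * i) / a by field_simp; ring]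
        exact hroot' had _
      · refine Finset.prod_ne_zero_iff.2 fun i hi => ?_
        rw [show ζ ^ 3 / (ζ / a) * (ζ ^ 2) ^ i = a * ζ ^ (2 + 2 * i) by field_simp; ring]
        exact hroot had _
    unfold quadTerm
    have h1 : 1 / ζ ^ (4 * m) ≠ 0 := one_div_ne_zero (pow_ne_zero _ hζ0)
    have h2 : ζ ^ (4 * m) ≠ 0 := pow_ne_zero _ hζ0
    have h3 : a * ζ ≠ 0 := mul_ne_zero ha0 hζ0
    have h4 : ζ ^ 3 / a * ζ ^ (4 * m) ≠ 0 :=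
      mul_ne_zero (div_ne_zero (pow_ne_zero _ hζ0) ha0) h2
    show ContinuousAt _ _
    refine ContinuousAt.mul (ContinuousAt.div ?_ ?_ hden) ?_
    · fun_prop (disch := assumption)
    · fun_prop (disch := assumption)
    · fun_prop
  have hPcont : ContinuousAt P ζ := by
    have h2 : ∀ j : ℕ, ζ ^ (4 * (j + 1)) ≠ 0 := fun j => pow_ne_zero _ hζ0
    simp only [P]
    refine tendsto_finsetProd _ fun j _ => ?_
    have := h2 j
    show ContinuousAt _ _
    fun_prop (disch := assumption)
  have hNcont : ContinuousAt N ζ := by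
    have h2 : ∀ j : ℕ, ζ ^ (4 * (j + 1)) ≠ 0 := fun j => pow_ne_zero _ hζ0
    simp only [N]
    refine ContinuousAt.mul (tendsto_finsetProd _ fun j _ => ?_) (by fun_prop)
    have := h2 j
    show ContinuousAt _ _
    fun_prop (disch := assumption)
  have hP : P ζ ≠ 0 := by
    refine Finset.prod_ne_zero_iff.2 fun j _ => mul_ne_zero (mul_ne_zero ?_ ?_)
      (mul_ne_zero ?_ ?_)
    · rw [mul_one_div, one_sub_div (pow_ne_zero _ hζ0), show ζ ^ (4 * (j + 1)) - c =
        -c * (1 - ζ ^ (4 * (j + 1)) / c) by field_simp; ring]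
      exact div_ne_zero (mul_ne_zero (neg_ne_zero.2 hc0) (hroot' hcd _)) (pow_ne_zero _ hζ0)
    · rw [div_div, one_sub_div (mul_ne_zero (pow_ne_zero _ hζ0) hc0),
        show ζ ^ (4 * (j + 1)) * c - 1 = -(1 - c * ζ ^ (4 * (j + 1))) by ring]
      exact div_ne_zero (neg_ne_zero.2 (hroot hcd _)) (mul_ne_zero (pow_ne_zero _ hζ0) hc0)
    · rw [show ζ ^ 3 / a * ζ ^ (4 * j) - 1 / ζ = -(1 - ζ ^ (4 * j + 4) / a) / ζ by
        field_simp; ring]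
      exact div_ne_zero (neg_ne_zero.2 (hroot' had _)) hζ0
    · rw [show ζ ^ 3 / a * ζ ^ (4 * j) - ζ = -(1 - ζ ^ (4 * j + 2) / a) * ζ by ring]
      exact mul_ne_zero (neg_ne_zero.2 (hroot' had _)) hζ0
  have hN : N ζ = 0 := by
    simp only [N]
    refine mul_eq_zero_of_left ?_ _
    rcases Nat.even_or_odd' m with ⟨r, hr | hr⟩
    · refine Finset.prod_eq_zero (i := r - 1) (Finset.mem_range.2 (by omega)) ?_
      refine mul_eq_zero_of_right _ (mul_eq_zero_of_right _ ?_)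
      rw [show 4 * (r - 1 + 1) = 2 * m by omega, sub_eq_zero, div_eq_iff (pow_ne_zero _ hζ0),
        ← pow_succ', hζd]
    · refine Finset.prod_eq_zero (i := r) (Finset.mem_range.2 (by omega)) ?_
      refine mul_eq_zero_of_right _ (mul_eq_zero_of_left ?_ _)
      rw [show 4 * (r + 1) = 2 * m + 1 + 1 by omega, pow_succ, hζd, one_mul, sub_self]
  have hS : S ζ = 0 := by
    have := transcendentalDisc_nhdsWithin_neBot hζn
    have h1 : Tendsto (fun q => P q * S q) (𝓝[transcendentalDisc] ζ) (𝓝 (P ζ * S ζ)) :=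
      (hPcont.mul hScont).mono_left nhdsWithin_le_nhds
    have h2 : Tendsto (fun q => P q * S q) (𝓝[transcendentalDisc] ζ) (𝓝 (N ζ)) :=
      (hNcont.mono_left nhdsWithin_le_nhds).congr' (by
        filter_upwards [self_mem_nhdsWithin] with q hq using (hPS q hq).symm)
    have := tendsto_nhds_unique h1 h2
    rw [hN] at this
    exact (mul_eq_zero.1 this).resolve_left hP
  rw [← Finset.sum_subset (Finset.range_subset_range.2 (show m + 1 ≤ d by omega))]
  · rw [← hS]
    refine Finset.sum_congr rfl fun k hk => ?_
    have hk := Finset.mem_range.1 hk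
    rw [hζ4, hζ3, ← quadTerm_eq_weight_mul hζ0 ha0]
    · simp only [quadTerm]
      ring
    · refine Finset.prod_ne_zero_iff.2 fun i hi => ?_
      have hi := Finset.mem_range.1 hi
      rw [← pow_mul, ← pow_succ']
      refine sub_ne_zero.2 (hodd fun h => ?_).symm
      have := Nat.le_of_dvd (by omega) h
      omega
  · intro k _ hk
    have hk : m < k := by simpa using hk
    have : qPoch (ζ ^ 2) (ζ ^ 4) k = 0 := qPoch_eq_zero hk (by
      rw [← pow_mul, ← pow_add, show 2 + 4 * m = (2 * m + 1) * 2 by ring, pow_mul, hζd, one_pow])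
    rw [weight, this]
    simp

end Complex

section DividedDifference

open Filter Topology

/-- `f` is differentiable at `(ζ, 0)` and so is its divided difference in the second variable. -/
def HasDividedDifference (ζ : ℂ) (f : ℂ × ℂ → ℂ) : Prop :=
  DifferentiableAt ℂ f (ζ, 0) ∧ ∃ g : ℂ × ℂ → ℂ, DifferentiableAt ℂ g (ζ, 0) ∧
    ∀ᶠ p in 𝓝 (ζ, (0 : ℂ)), f p = f (p.1, 0) + p.2 * g p

lemma DifferentiableAt.restrict_fst {ζ : ℂ} {f : ℂ × ℂ → ℂ} (hf : DifferentiableAt ℂ f (ζ, 0)) :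
    DifferentiableAt ℂ (fun p : ℂ × ℂ => f (p.1, 0)) (ζ, 0) :=
  DifferentiableAt.comp (g := f) (f := fun p : ℂ × ℂ => (p.1, (0 : ℂ))) (ζ, (0 : ℂ)) hf
    (by fun_prop)

namespace HasDividedDifference

variable {ζ : ℂ} {f f₁ f₂ : ℂ × ℂ → ℂ}

lemma one (ζ : ℂ) : HasDividedDifference ζ fun _ => 1 :=
  ⟨by fun_prop, fun _ => 0, by fun_prop, by simp⟩

lemma mul (h₁ : HasDividedDifference ζ f₁) (h₂ : HasDividedDifference ζ f₂) :
    HasDividedDifference ζ fun p => f₁ p * f₂ p := by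
  obtain ⟨d₁, g₁, e₁, h₁⟩ := h₁
  obtain ⟨d₂, g₂, e₂, h₂⟩ := h₂
  refine ⟨d₁.mul d₂, fun p => g₁ p * f₂ p + f₁ (p.1, 0) * g₂ p,
    (e₁.mul d₂).add (d₁.restrict_fst.mul e₂), ?_⟩
  filter_upwards [h₁, h₂] with p h₁ h₂
  linear_combination f₂ p * h₁ + f₁ (p.1, 0) * h₂

lemma inv (h : HasDividedDifference ζ f) (h0 : f (ζ, 0) ≠ 0) :
    HasDividedDifference ζ fun p => (f p)⁻¹ := by
  obtain ⟨d, g, e, h⟩ := h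
  refine ⟨d.inv h0, fun p => -(g p * ((f p)⁻¹ * (f (p.1, 0))⁻¹)),
    (e.mul ((d.inv h0).mul (d.restrict_fst.inv h0))).neg, ?_⟩
  filter_upwards [h, d.continuousAt.eventually_ne h0,
    d.restrict_fst.continuousAt.eventually_ne h0] with p h hp hp0
  field_simp
  linear_combination -h

lemma div (h₁ : HasDividedDifference ζ f₁) (h₂ : HasDividedDifference ζ f₂)
    (h0 : f₂ (ζ, 0) ≠ 0) : HasDividedDifference ζ fun p => f₁ p / f₂ p := by
  simp only [div_eq_mul_inv]
  exact h₁.mul (h₂.inv h0)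

lemma prod {ι : Type*} {F : ι → ℂ × ℂ → ℂ} (s : Finset ι)
    (h : ∀ i ∈ s, HasDividedDifference ζ (F i)) :
    HasDividedDifference ζ fun p => ∏ i ∈ s, F i p := by
  classical
  induction s using Finset.induction_on with
  | empty => simpa using one ζ
  | insert i s hi ih =>
    simp only [Finset.prod_insert hi]
    exact (h i (Finset.mem_insert_self _ _)).mul
      (ih fun j hj => h j (Finset.mem_insert_of_mem hj))

lemma basic (ζ : ℂ) (e : ℕ) :
    HasDividedDifference ζ fun p => (1 - p.1 ^ e) ^ 2 + p.1 ^ e * p.2 :=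
  ⟨by fun_prop, fun p => p.1 ^ e, by fun_prop, Eventually.of_forall fun p => by ring⟩

end HasDividedDifference

lemma one_sub_mul_mul_one_sub_div {c : ℂ} (hc : c ≠ 0) (x : ℂ) :
    (1 - c * x) * (1 - x / c) = (1 - x) ^ 2 + x * (-(1 - c) ^ 2 / c) := by
  field_simp
  ring

/-- The product of `(c * q ^ s; q ^ t)_k` and `(q ^ s / c; q ^ t)_k` as a function of `q` and
`C = -(1 - c) ^ 2 / c`. -/
def pairPoch (s t k : ℕ) (p : ℂ × ℂ) : ℂ :=
  ∏ i ∈ Finset.range k, ((1 - p.1 ^ (s + t * i)) ^ 2 + p.1 ^ (s + t * i) * p.2)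

lemma qPoch_mul_qPoch {c : ℂ} (hc : c ≠ 0) (q : ℂ) (s t k : ℕ) :
    qPoch (c * q ^ s) (q ^ t) k * qPoch (q ^ s / c) (q ^ t) k =
      pairPoch s t k (q, -(1 - c) ^ 2 / c) := by
  simp only [qPoch, pairPoch]
  rw [← Finset.prod_mul_distrib]
  refine Finset.prod_congr rfl fun i _ => ?_
  rw [← one_sub_mul_mul_one_sub_div hc, pow_add, pow_mul]
  ring

lemma pairPoch_zero_ne_zero {q : ℂ} {s t k : ℕ} (h : ∀ i < k, q ^ (s + t * i) ≠ 1) :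
    pairPoch s t k (q, 0) ≠ 0 :=
  Finset.prod_ne_zero_iff.2 fun i hi => by
    simpa using sub_ne_zero.2 (h i (Finset.mem_range.1 hi)).symm

lemma hasDividedDifference_pairPoch (ζ : ℂ) (s t k : ℕ) :
    HasDividedDifference ζ (pairPoch s t k) :=
  HasDividedDifference.prod _ fun i _ => HasDividedDifference.basic ζ (s + t * i)

/-- `cFactor` in terms of `-(1 - c) ^ 2 / c`. -/
noncomputable def cPair (k : ℕ) (p : ℂ × ℂ) : ℂ := pairPoch 1 2 k p / pairPoch 4 4 k p

/-- `aFactor` in terms of `-(1 - a) ^ 2 / a`. -/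
noncomputable def aPair (k : ℕ) (p : ℂ × ℂ) : ℂ := pairPoch 1 4 k p / pairPoch 2 2 k p

lemma cFactor_eq {c : ℂ} (hc : c ≠ 0) (q : ℂ) (k : ℕ) :
    cFactor q c k = cPair k (q, -(1 - c) ^ 2 / c) := by
  have h1 := qPoch_mul_qPoch hc q 1 2 k
  rw [pow_one] at h1
  rw [cFactor, cPair, h1, qPoch_mul_qPoch hc q 4 4]

lemma aFactor_eq {a : ℂ} (ha : a ≠ 0) (q : ℂ) (k : ℕ) :
    aFactor q a k = aPair k (q, -(1 - a) ^ 2 / a) := by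
  have h1 := qPoch_mul_qPoch ha q 1 4 k
  rw [pow_one] at h1
  rw [aFactor, aPair, h1, qPoch_mul_qPoch ha q 2 2]

lemma IsPrimitiveRoot.pow_two_mul_ne_one {ζ : ℂ} {d : ℕ} (hζ : IsPrimitiveRoot ζ d)
    (hd : Odd d) {j : ℕ} (hj : ζ ^ j ≠ 1) : ζ ^ (2 * j) ≠ 1 := fun h =>
  hj (hζ.pow_eq_one_iff_dvd j |>.2
    ((Nat.coprime_two_right.2 hd).dvd_of_dvd_mul_left (hζ.dvd_of_pow_eq_one _ h)))

lemma IsPrimitiveRoot.pow_ne_one_of_lt {ζ : ℂ} {d : ℕ} (hζ : IsPrimitiveRoot ζ d)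
    {j : ℕ} (hj0 : 0 < j) (hj : j < d) : ζ ^ j ≠ 1 := hζ.pow_ne_one_of_pos_of_lt hj0.ne' hj

lemma hasDividedDifference_cPair {ζ : ℂ} {d : ℕ} (hζ : IsPrimitiveRoot ζ d) (hd : Odd d) {k : ℕ}
    (hk : k < d) : HasDividedDifference ζ (cPair k) :=
  (hasDividedDifference_pairPoch ζ 1 2 k).div (hasDividedDifference_pairPoch ζ 4 4 k)
    (pairPoch_zero_ne_zero fun i hi => by
      rw [show 4 + 4 * i = 2 * (2 * (i + 1)) by ring]
      exact hζ.pow_two_mul_ne_one hd (hζ.pow_two_mul_ne_one hd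
        (hζ.pow_ne_one_of_lt (by omega) (by omega))))

lemma hasDividedDifference_aPair {ζ : ℂ} {d : ℕ} (hζ : IsPrimitiveRoot ζ d) (hd : Odd d) {k : ℕ}
    (hk : k < d) : HasDividedDifference ζ (aPair k) :=
  (hasDividedDifference_pairPoch ζ 1 4 k).div (hasDividedDifference_pairPoch ζ 2 2 k)
    (pairPoch_zero_ne_zero fun i hi => by
      rw [show 2 + 2 * i = 2 * (i + 1) by ring]
      exact hζ.pow_two_mul_ne_one hd (hζ.pow_ne_one_of_lt (by omega) (by omega)))

lemma exists_dividedDifference_cPair {ζ : ℂ} {d : ℕ} (hζ : IsPrimitiveRoot ζ d) (hd : Odd d) :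
    ∃ u : ℕ → ℂ × ℂ → ℂ, ∀ k < d, DifferentiableAt ℂ (u k) (ζ, 0) ∧
      ∀ᶠ p in 𝓝 (ζ, (0 : ℂ)), cPair k p = cPair k (p.1, 0) + p.2 * u k p := by
  have h : ∀ k, ∃ u : ℂ × ℂ → ℂ, k < d → DifferentiableAt ℂ u (ζ, 0) ∧
      ∀ᶠ p in 𝓝 (ζ, (0 : ℂ)), cPair k p = cPair k (p.1, 0) + p.2 * u p := fun k => by
    by_cases hk : k < d
    · obtain ⟨_, u, hu⟩ := hasDividedDifference_cPair hζ hd hk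
      exact ⟨u, fun _ => hu⟩
    · exact ⟨0, fun h => absurd h hk⟩
  choose u hu using h
  exact ⟨u, hu⟩

lemma exists_dividedDifference_aPair {ζ : ℂ} {d : ℕ} (hζ : IsPrimitiveRoot ζ d) (hd : Odd d) :
    ∃ u : ℕ → ℂ × ℂ → ℂ, ∀ k < d, DifferentiableAt ℂ (u k) (ζ, 0) ∧
      ∀ᶠ p in 𝓝 (ζ, (0 : ℂ)), aPair k p = aPair k (p.1, 0) + p.2 * u k p := by
  have h : ∀ k, ∃ u : ℂ × ℂ → ℂ, k < d → DifferentiableAt ℂ u (ζ, 0) ∧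
      ∀ᶠ p in 𝓝 (ζ, (0 : ℂ)), aPair k p = aPair k (p.1, 0) + p.2 * u p := fun k => by
    by_cases hk : k < d
    · obtain ⟨_, u, hu⟩ := hasDividedDifference_aPair hζ hd hk
      exact ⟨u, fun _ => hu⟩
    · exact ⟨0, fun h => absurd h hk⟩
  choose u hu using h
  exact ⟨u, hu⟩

/-- The values `-(1 - c) ^ 2 / c` for `c` on the unit circle with `c ^ d ≠ 1`. -/
def circleValues (d : ℕ) : Set ℂ := {C | ∃ c : ℂ, ‖c‖ = 1 ∧ c ^ d ≠ 1 ∧ C = -(1 - c) ^ 2 / c}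

lemma circleValues_nhdsWithin_neBot {d : ℕ} (hd : 0 < d) : (𝓝[circleValues d] 0).NeBot := by
  rw [← mem_closure_iff_nhdsWithin_neBot]
  let c : ℕ → ℂ := fun N => Complex.exp (2 * Real.pi * Complex.I / N)
  have hc : Tendsto c atTop (𝓝 1) := by
    have h1 : Tendsto (fun N : ℕ => 2 * Real.pi * Complex.I / (N : ℂ)) atTop (𝓝 0) :=
      tendsto_const_div_atTop_nhds_zero_nat _
    have h2 := (Complex.continuous_exp.tendsto 0).comp h1
    rwa [Complex.exp_zero] at h2
  have hC : Tendsto (fun N => -(1 - c N) ^ 2 / c N) atTop (𝓝 0) := by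
    have h1 : ContinuousAt (fun z : ℂ => -(1 - z) ^ 2 / z) 1 := by
      fun_prop (disch := exact one_ne_zero)
    have h2 := h1.tendsto.comp hc
    simpa [Function.comp_def] using h2
  refine mem_closure_of_tendsto hC ?_
  filter_upwards [eventually_gt_atTop d] with N hN
  have hroot := Complex.isPrimitiveRoot_exp N (by omega)
  exact ⟨c N, hroot.norm'_eq_one (by omega), hroot.pow_ne_one_of_pos_of_lt hd.ne' hN, rfl⟩

lemma ne_zero_of_mem_circleValues {d : ℕ} {C : ℂ} (hC : C ∈ circleValues d) : C ≠ 0 := by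
  obtain ⟨c, hc, hcd, rfl⟩ := hC
  have hc0 : c ≠ 0 := norm_ne_zero_iff.1 (by rw [hc]; exact one_ne_zero)
  refine div_ne_zero (neg_ne_zero.2 (pow_ne_zero _ (sub_ne_zero.2 fun h => hcd ?_))) hc0
  rw [← h, one_pow]

lemma eq_zero_of_forall_circleValues {d : ℕ} (hd : 0 < d) {f g : ℂ → ℂ} (hg : ContinuousAt g 0)
    (hfg : ∀ᶠ C in 𝓝 0, f C = f 0 + C * g C) (hf : ∀ C ∈ circleValues d, f C = 0) :
    f 0 = 0 ∧ g 0 = 0 := by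
  have := circleValues_nhdsWithin_neBot hd
  have hg' : Tendsto g (𝓝[circleValues d] 0) (𝓝 (g 0)) := hg.mono_left nhdsWithin_le_nhds
  have hfg' := hfg.filter_mono (nhdsWithin_le_nhds (s := circleValues d))
  have h0 : f 0 = 0 := by
    have h1 : Tendsto (fun C => -(C * g C)) (𝓝[circleValues d] 0) (𝓝 (-(0 * g 0))) :=
      ((tendsto_id.mono_left nhdsWithin_le_nhds).mul hg').neg
    have h2 : Tendsto (fun C => -(C * g C)) (𝓝[circleValues d] 0) (𝓝 (f 0)) :=
      tendsto_const_nhds.congr' (by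
        filter_upwards [hfg', self_mem_nhdsWithin] with C h hC
        rw [hf C hC] at h
        linear_combination -h)
    simpa using tendsto_nhds_unique h2 h1
  refine ⟨h0, tendsto_nhds_unique hg' (tendsto_const_nhds.congr' ?_)⟩
  filter_upwards [hfg', self_mem_nhdsWithin] with C h hC
  rw [hf C hC, h0, zero_add] at h
  exact ((mul_eq_zero.1 h.symm).resolve_left (ne_zero_of_mem_circleValues hC)).symm

end DividedDifference

section Estimate

open Filter Topology Asymptotics

lemma sum_weight_cPair_aPair_eq_zero {ζ : ℂ} {d : ℕ} (hζ : IsPrimitiveRoot ζ d) (hd : Odd d)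
    (hd1 : 1 < d) {u v : ℕ → ℂ × ℂ → ℂ} (hu : ∀ k < d, DifferentiableAt ℂ (u k) (ζ, 0))
    (hv : ∀ k < d, DifferentiableAt ℂ (v k) (ζ, 0))
    (hu' : ∀ k < d, ∀ᶠ p in 𝓝 (ζ, (0 : ℂ)), cPair k p = cPair k (p.1, 0) + p.2 * u k p)
    (hv' : ∀ k < d, ∀ᶠ p in 𝓝 (ζ, (0 : ℂ)), aPair k p = aPair k (p.1, 0) + p.2 * v k p) :
    ∑ k ∈ Finset.range d, weight ζ k * cPair k (ζ, 0) * aPair k (ζ, 0) = 0 ∧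
      ∑ k ∈ Finset.range d, weight ζ k * u k (ζ, 0) * v k (ζ, 0) = 0 := by
  obtain ⟨m, hm⟩ := hd
  have hmk : ContinuousAt (fun C : ℂ => (ζ, C)) 0 := by fun_prop
  have hu0 : ∀ᶠ C in 𝓝 (0 : ℂ), ∀ k ∈ Finset.range d,
      cPair k (ζ, C) = cPair k (ζ, 0) + C * u k (ζ, C) :=
    (Finset.eventually_all _).2 fun k hk => hmk.eventually (hu' k (Finset.mem_range.1 hk))
  have hv0 : ∀ᶠ C in 𝓝 (0 : ℂ), ∀ k ∈ Finset.range d,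
      aPair k (ζ, C) = aPair k (ζ, 0) + C * v k (ζ, C) :=
    (Finset.eventually_all _).2 fun k hk => hmk.eventually (hv' k (Finset.mem_range.1 hk))
  have huc : ∀ k ∈ Finset.range d, ContinuousAt (fun C : ℂ => u k (ζ, C)) 0 := fun k hk =>
    ContinuousAt.comp (g := u k) (hu k (Finset.mem_range.1 hk)).continuousAt hmk
  have hvc : ∀ k ∈ Finset.range d, ContinuousAt (fun C : ℂ => v k (ζ, C)) 0 := fun k hk =>
    ContinuousAt.comp (g := v k) (hv k (Finset.mem_range.1 hk)).continuousAt hmk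
  have hfirst : ∀ A ∈ circleValues d,
      ∑ k ∈ Finset.range d, weight ζ k * cPair k (ζ, 0) * aPair k (ζ, A) = 0 ∧
        ∑ k ∈ Finset.range d, weight ζ k * u k (ζ, 0) * aPair k (ζ, A) = 0 := by
    rintro A ⟨a, ha, had, rfl⟩
    refine eq_zero_of_forall_circleValues (d := d) (by omega)
      (f := fun C => ∑ k ∈ Finset.range d, weight ζ k * cPair k (ζ, C) *
        aPair k (ζ, -(1 - a) ^ 2 / a))
      (g := fun C => ∑ k ∈ Finset.range d, weight ζ k * u k (ζ, C) *
        aPair k (ζ, -(1 - a) ^ 2 / a)) ?_ ?_ ?_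
    · exact tendsto_finsetSum _ fun k hk =>
        ((continuousAt_const.mul (huc k hk)).mul continuousAt_const)
    · filter_upwards [hu0] with C hC
      rw [Finset.mul_sum, ← Finset.sum_add_distrib]
      refine Finset.sum_congr rfl fun k hk => ?_
      rw [hC k hk]
      ring
    · rintro C ⟨c, hc, hcd, rfl⟩
      have ha0 : a ≠ 0 := norm_ne_zero_iff.1 (by rw [ha]; exact one_ne_zero)
      have hc0 : c ≠ 0 := norm_ne_zero_iff.1 (by rw [hc]; exact one_ne_zero)
      simp only [← cFactor_eq hc0, ← aFactor_eq ha0]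
      exact sum_weight_eq_zero hm (by omega) hζ ha hc had hcd
  constructor
  · refine (eq_zero_of_forall_circleValues (d := d) (by omega)
      (f := fun A => ∑ k ∈ Finset.range d, weight ζ k * cPair k (ζ, 0) * aPair k (ζ, A))
      (g := fun A => ∑ k ∈ Finset.range d, weight ζ k * cPair k (ζ, 0) * v k (ζ, A))
      ?_ ?_ fun A hA => (hfirst A hA).1).1
    · exact tendsto_finsetSum _ fun k hk => continuousAt_const.mul (hvc k hk)
    · filter_upwards [hv0] with A hA
      rw [Finset.mul_sum, ← Finset.sum_add_distrib]
      refine Finset.sum_congr rfl fun k hk => ?_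
      rw [hA k hk]
      ring
  · refine (eq_zero_of_forall_circleValues (d := d) (by omega)
      (f := fun A => ∑ k ∈ Finset.range d, weight ζ k * u k (ζ, 0) * aPair k (ζ, A))
      (g := fun A => ∑ k ∈ Finset.range d, weight ζ k * u k (ζ, 0) * v k (ζ, A))
      ?_ ?_ fun A hA => (hfirst A hA).2).2
    · exact tendsto_finsetSum _ fun k hk => continuousAt_const.mul (hvc k hk)
    · filter_upwards [hv0] with A hA
      rw [Finset.mul_sum, ← Finset.sum_add_distrib]
      refine Finset.sum_congr rfl fun k hk => ?_
      rw [hA k hk]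
      ring

/-- The truncated series at `a = c = 1`, without its factor `1 / (1 - q)`. -/
noncomputable def baseSum (n : ℕ) (q : ℂ) : ℂ :=
  ∑ k ∈ Finset.range n, weight q k * cPair k (q, 0) * aPair k (q, 0)

lemma sum_weight_cPair_aPair_base {ζ : ℂ} {d : ℕ} (hζ : IsPrimitiveRoot ζ d) (hd : Odd d)
    (hd1 : 1 < d) : baseSum d ζ = 0 := by
  obtain ⟨u, hu⟩ := exists_dividedDifference_cPair hζ hd
  obtain ⟨v, hv⟩ := exists_dividedDifference_aPair hζ hd
  exact (sum_weight_cPair_aPair_eq_zero hζ hd hd1 (fun k hk => (hu k hk).1)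
    (fun k hk => (hv k hk).1) (fun k hk => (hu k hk).2) (fun k hk => (hv k hk).2)).1

end Estimate

section MainEstimate

open Filter Topology Asymptotics

lemma qPoch_ne_zero_of_pow_ne_one {K : Type*} [Field K] {q : K} (hq : ∀ j : ℕ, 0 < j → q ^ j ≠ 1)
    {s : ℕ} (hs : 0 < s) (t k : ℕ) : qPoch (q ^ s) (q ^ t) k ≠ 0 :=
  qPoch_ne_zero (fun i => by
    rw [← pow_mul, ← pow_add]
    exact sub_ne_zero.2 (hq _ (by omega)).symm) k

lemma one_sub_pow_div_pow_ne_zero {K : Type*} [Field K] {q : K} (hq0 : q ≠ 0)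
    (hq : ∀ j : ℕ, 0 < j → q ^ j ≠ 1) {i j : ℕ} (hij : i ≠ j) : 1 - q ^ i / q ^ j ≠ 0 := by
  rw [sub_ne_zero, ne_comm, Ne, div_eq_one_iff_eq (pow_ne_zero _ hq0)]
  intro h
  rcases lt_or_gt_of_ne hij with h' | h'
  · obtain ⟨r, rfl⟩ := Nat.exists_eq_add_of_lt h'
    refine hq (r + 1) (by omega) (mul_left_cancel₀ (pow_ne_zero i hq0) ?_)
    rw [mul_one, ← pow_add, ← add_assoc, h]
  · obtain ⟨r, rfl⟩ := Nat.exists_eq_add_of_lt h'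
    refine hq (r + 1) (by omega) (mul_left_cancel₀ (pow_ne_zero j hq0) ?_)
    rw [mul_one, ← pow_add, ← add_assoc, h]

lemma sum_weight_eq_sum_quadTerm {q a c : ℂ} (hq0 : q ≠ 0) (hq : ∀ j : ℕ, 0 < j → q ^ j ≠ 1)
    (ha : a ≠ 0) (hc : c ≠ 0) (n : ℕ) :
    ∑ k ∈ Finset.range n, weight q k * cPair k (q, -(1 - c) ^ 2 / c) *
      aPair k (q, -(1 - a) ^ 2 / a) =
    ∑ k ∈ Finset.range n, quadTerm q c (a * q) (q / a) (q ^ 2) k := by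
  refine Finset.sum_congr rfl fun k _ => ?_
  rw [← cFactor_eq hc, ← aFactor_eq ha, quadTerm_eq_weight_mul hq0 ha]
  simpa using qPoch_ne_zero_of_pow_ne_one hq one_pos 2 k

lemma sum_weight_first {q : ℂ} (hq0 : q ≠ 0) (hq : ∀ j : ℕ, 0 < j → q ^ j ≠ 1) (m : ℕ) :
    ∑ k ∈ Finset.range (4 * m + 3), weight q k *
      cPair k (q, -(1 - q ^ (4 * m + 3)) ^ 2 / q ^ (4 * m + 3)) * aPair k (q, 0) = 0 := by
  have h := sum_weight_eq_sum_quadTerm hq0 hq one_ne_zero (pow_ne_zero (4 * m + 3) hq0) (4 * m + 3)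
  simp only [sub_self, one_mul, div_one] at h
  rw [sum_quadTerm_cubic_eq_zero hq0 hq m (by omega)] at h
  simpa using h

/-- The value of the truncated series at `a = q ^ (3 * n)`, without the factor `1 - q ^ (3 * n)`. -/
noncomputable def closedForm (M : ℕ) (p : ℂ × ℂ) : ℂ := pairPoch 2 4 M p / pairPoch 4 4 M p

lemma sum_weight_second {q c : ℂ} (hq0 : q ≠ 0) (hq : ∀ j : ℕ, 0 < j → q ^ j ≠ 1) (hc : c ≠ 0)
    (hc4 : ∀ i : ℕ, 1 - c * q ^ 4 * (q ^ 4) ^ i ≠ 0)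
    (hc4' : ∀ i : ℕ, 1 - q ^ 4 / c * (q ^ 4) ^ i ≠ 0) {M n : ℕ} (hM : M < n) :
    ∑ k ∈ Finset.range n, weight q k * cPair k (q, -(1 - c) ^ 2 / c) *
      aPair k (q, -(1 - q ^ (4 * M + 1)) ^ 2 / q ^ (4 * M + 1)) =
    (1 - q ^ (4 * M + 1)) * closedForm M (q, -(1 - c) ^ 2 / c) := by
  rw [sum_weight_eq_sum_quadTerm hq0 hq (pow_ne_zero _ hq0) hc, sum_quadTerm_two hq0 hc hq hc4 hc4'
    hM, qPoch_mul_qPoch hc, qPoch_mul_qPoch hc, closedForm]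

lemma isBigO_one_sub_pow {ζ : ℂ} {n : ℕ} (hζ : ζ ^ n = 1) :
    (fun q : ℂ => 1 - q ^ n) =O[𝓝 ζ] fun q => q - ζ := by
  have h : DifferentiableAt ℂ (fun q : ℂ => 1 - q ^ n) ζ := by fun_prop
  simpa [hζ] using h.isBigO_sub

lemma baseSum_sub_isBigO {ζ : ℂ} {m n M : ℕ} (hn : n = 4 * m + 3) (hM : M = 3 * m + 2)
    (hζ : IsPrimitiveRoot ζ n) :
    (fun q : ℂ => baseSum n q - (1 - q ^ (3 * n)) *
      (q ^ (2 * n) * (2 - q ^ n) / (1 + q ^ n) ^ 2) * closedForm M (q, 0))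
      =O[𝓝[transcendentalDisc] ζ] fun q => (q - ζ) ^ 5 := by
  have hodd : Odd n := ⟨2 * m + 1, by omega⟩
  have hζ0 : ζ ≠ 0 := hζ.ne_zero (by omega)
  have hζn : ζ ^ n = 1 := hζ.pow_eq_one
  obtain ⟨u, hu⟩ := exists_dividedDifference_cPair hζ hodd
  obtain ⟨v, hv⟩ := exists_dividedDifference_aPair hζ hodd
  have hΨ := (sum_weight_cPair_aPair_eq_zero hζ hodd (by omega) (fun k hk => (hu k hk).1)
    (fun k hk => (hv k hk).1) (fun k hk => (hu k hk).2) (fun k hk => (hv k hk).2)).2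
  have hDne : pairPoch 4 4 M (ζ, 0) ≠ 0 := pairPoch_zero_ne_zero fun i hi => by
    rw [show 4 + 4 * i = 2 * (2 * (i + 1)) by ring]
    exact hζ.pow_two_mul_ne_one hodd (hζ.pow_two_mul_ne_one hodd
      (hζ.pow_ne_one_of_lt (by omega) (by omega)))
  let Y : ℂ × ℂ → ℂ := fun p => (∏ i ∈ (Finset.range M).erase (2 * m + 1),
    ((1 - p.1 ^ (2 + 4 * i)) ^ 2 + p.1 ^ (2 + 4 * i) * p.2)) / pairPoch 4 4 M p
  have hY : HasDividedDifference ζ Y :=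
    (HasDividedDifference.prod _ fun i _ => HasDividedDifference.basic ζ (2 + 4 * i)).div
      (hasDividedDifference_pairPoch ζ 4 4 M) hDne
  have hcf : ∀ p : ℂ × ℂ, closedForm M p =
      ((1 - (p.1 ^ n) ^ 2) ^ 2 + (p.1 ^ n) ^ 2 * p.2) * Y p := fun p => by
    rw [closedForm, pairPoch, ← Finset.mul_prod_erase _ _
      (Finset.mem_range.2 (show 2 * m + 1 < M by omega)), mul_div_assoc, ← pow_mul,
      show 2 + 4 * (2 * m + 1) = n * 2 by omega]
  obtain ⟨hYd, y, hyd, hy⟩ := hY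
  let C : ℂ → ℂ := fun q => -(1 - q ^ n) ^ 2 / q ^ n
  let A : ℂ → ℂ := fun q => -(1 - q ^ (3 * n)) ^ 2 / q ^ (3 * n)
  have hζn0 : ζ ^ n ≠ 0 := pow_ne_zero _ hζ0
  have hζn30 : ζ ^ (3 * n) ≠ 0 := pow_ne_zero _ hζ0
  have hCd : DifferentiableAt ℂ (fun q => (q, C q)) ζ := by
    simp only [C]
    fun_prop (disch := assumption)
  have hAd : DifferentiableAt ℂ (fun q => (q, A q)) ζ := by
    simp only [A]
    fun_prop (disch := assumption)
  have hCζ : C ζ = 0 := by simp [C, hζn]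
  have hAζ : A ζ = 0 := by simp [A, mul_comm 3 n, pow_mul, hζn]
  have hcompC : ∀ {f : ℂ × ℂ → ℂ}, DifferentiableAt ℂ f (ζ, 0) →
      DifferentiableAt ℂ (fun q => f (q, C q)) ζ := fun {f} hf =>
    DifferentiableAt.comp (g := f) (f := fun q => (q, C q)) ζ (by simpa [hCζ] using hf) hCd
  have hcompA : ∀ {f : ℂ × ℂ → ℂ}, DifferentiableAt ℂ f (ζ, 0) →
      DifferentiableAt ℂ (fun q => f (q, A q)) ζ := fun {f} hf =>
    DifferentiableAt.comp (g := f) (f := fun q => (q, A q)) ζ (by simpa [hAζ] using hf) hAd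
  have hcomp0 : ∀ {f : ℂ × ℂ → ℂ}, DifferentiableAt ℂ f (ζ, 0) →
      DifferentiableAt ℂ (fun q => f (q, 0)) ζ := fun {f} hf =>
    DifferentiableAt.comp (g := f) (f := fun q => (q, (0 : ℂ))) ζ hf (by fun_prop)
  have hCt : Tendsto (fun q => (q, C q)) (𝓝 ζ) (𝓝 (ζ, 0)) := by
    simpa [ContinuousAt, hCζ] using hCd.continuousAt
  have hAt : Tendsto (fun q => (q, A q)) (𝓝 ζ) (𝓝 (ζ, 0)) := by
    simpa [ContinuousAt, hAζ] using hAd.continuousAt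
  have hweight : ∀ k < n, DifferentiableAt ℂ (fun q => weight q k) ζ := fun k hk => by
    have hne : qPoch (ζ ^ 4) (ζ ^ 4) k ≠ 0 := Finset.prod_ne_zero_iff.2 fun i hi => by
      have hi := Finset.mem_range.1 hi
      rw [← pow_mul, ← pow_add, show 4 + 4 * i = 2 * (2 * (i + 1)) by ring]
      exact sub_ne_zero.2 (hζ.pow_two_mul_ne_one hodd (hζ.pow_two_mul_ne_one hodd
        (hζ.pow_ne_one_of_lt (by omega) (by omega)))).symm
    have hd : ∀ s t : ℕ, DifferentiableAt ℂ (fun q : ℂ => qPoch (q ^ s) (q ^ t) k) ζ :=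
      fun s t => by
        unfold qPoch
        fun_prop
    unfold weight
    exact (DifferentiableAt.mul (by fun_prop) ((hd 2 4).div (hd 4 4) hne)).mul (by fun_prop)
  let Ψ : ℂ → ℂ := fun q => ∑ k ∈ Finset.range n, weight q k * u k (q, C q) * v k (q, A q)
  have hΨd : DifferentiableAt ℂ Ψ ζ := DifferentiableAt.fun_sum fun k hk => by
    have hk := Finset.mem_range.1 hk
    exact ((hweight k hk).mul (hcompC (hu k hk).1)).mul (hcompA (hv k hk).1)
  let B : ℂ → ℂ := fun q => (1 + q ^ n + (q ^ n) ^ 2) ^ 2 / (q ^ n) ^ 4 * Ψ q +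
    (1 - q ^ n) * (1 + q ^ n + (q ^ n) ^ 2) *
      (q ^ n * Y (q, 0) + (1 + q ^ n + (q ^ n) ^ 2) * y (q, C q) / q ^ n)
  have hBd : DifferentiableAt ℂ B ζ := by
    have h1 := hcomp0 hYd
    have h2 := hcompC hyd
    have h3 : (ζ ^ n) ^ 4 ≠ 0 := pow_ne_zero _ hζn0
    have h4 : DifferentiableAt ℂ (fun q : ℂ => (1 + q ^ n + (q ^ n) ^ 2)) ζ := by fun_prop
    have h5 : DifferentiableAt ℂ (fun q : ℂ => q ^ n) ζ := by fun_prop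
    exact (((h4.pow 2).div (h5.pow 4) h3).mul hΨd).add
      ((((differentiableAt_const _).sub h5).mul h4).mul ((h5.mul h1).add ((h4.mul h2).div h5 hζn0)))
  have hBζ : B ζ = 0 := by
    have : Ψ ζ = 0 := by simpa [Ψ, hCζ, hAζ] using hΨ
    simp [B, this, hζn]
  have hBO : B =O[𝓝 ζ] fun q => q - ζ := by simpa [hBζ] using hBd.isBigO_sub
  have hfin : (fun q : ℂ => (1 - q ^ n) ^ 4 * B q) =O[𝓝[transcendentalDisc] ζ]
      fun q => (q - ζ) ^ 5 := by
    refine IsBigO.mono ?_ nhdsWithin_le_nhds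
    exact (((isBigO_one_sub_pow hζn).pow 4).mul hBO).congr_right fun q => by ring
  refine hfin.congr' ?_ EventuallyEq.rfl
  have hu' : ∀ᶠ q in 𝓝 ζ, ∀ k ∈ Finset.range n,
      cPair k (q, C q) = cPair k (q, 0) + C q * u k (q, C q) :=
    (Finset.eventually_all _).2 fun k hk => hCt.eventually (hu k (Finset.mem_range.1 hk)).2
  have hv' : ∀ᶠ q in 𝓝 ζ, ∀ k ∈ Finset.range n,
      aPair k (q, A q) = aPair k (q, 0) + A q * v k (q, A q) :=
    (Finset.eventually_all _).2 fun k hk => hAt.eventually (hv k (Finset.mem_range.1 hk)).2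
  have hone : ∀ᶠ q in 𝓝 ζ, 1 + q ^ n ≠ 0 := by
    have h : ContinuousAt (fun q : ℂ => 1 + q ^ n) ζ := by fun_prop
    refine h.eventually_ne ?_
    rw [hζn]
    norm_num
  filter_upwards [nhdsWithin_le_nhds hu', nhdsWithin_le_nhds hv',
    nhdsWithin_le_nhds (hCt.eventually hy), nhdsWithin_le_nhds hone, self_mem_nhdsWithin]
    with q hu' hv' hy hone hq
  have hq0 := ne_zero_of_mem_transcendentalDisc hq
  have hqj : ∀ j : ℕ, 0 < j → q ^ j ≠ 1 := fun j hj => pow_ne_one_of_norm_lt_one hq.1 hj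
  have hx0 : q ^ n ≠ 0 := pow_ne_zero _ hq0
  have h3n : 4 * M + 1 = 3 * n := by omega
  have hcross : ∑ k ∈ Finset.range n, weight q k * cPair k (q, C q) * aPair k (q, A q) -
      ∑ k ∈ Finset.range n, weight q k * cPair k (q, C q) * aPair k (q, 0) -
      ∑ k ∈ Finset.range n, weight q k * cPair k (q, 0) * aPair k (q, A q) + baseSum n q =
      C q * A q * Ψ q := by
    rw [baseSum, ← Finset.sum_sub_distrib, ← Finset.sum_sub_distrib, ← Finset.sum_add_distrib,
      Finset.mul_sum]
    refine Finset.sum_congr rfl fun k hk => ?_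
    rw [hu' k hk, hv' k hk]
    ring
  have hCC : ∑ k ∈ Finset.range n, weight q k * cPair k (q, C q) * aPair k (q, A q) =
      (1 - q ^ (3 * n)) * closedForm M (q, C q) := by
    have h := sum_weight_second (M := M) (n := n) hq0 hqj hx0
      (fun i => by
        rw [← pow_mul, ← pow_add, ← pow_add]
        exact sub_ne_zero.2 (hqj _ (by omega)).symm)
      (fun i => by
        rw [← pow_mul, div_mul_eq_mul_div, ← pow_add]
        exact one_sub_pow_div_pow_ne_zero hq0 hqj (by omega)) (by omega)
    rwa [h3n] at h
  have hC0 : ∑ k ∈ Finset.range n, weight q k * cPair k (q, C q) * aPair k (q, 0) = 0 := by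
    have h := sum_weight_first hq0 hqj m
    rwa [← hn] at h
  have h0A : ∑ k ∈ Finset.range n, weight q k * cPair k (q, 0) * aPair k (q, A q) =
      (1 - q ^ (3 * n)) * closedForm M (q, 0) := by
    have h := sum_weight_second (M := M) (n := n) hq0 hqj one_ne_zero
      (fun i => by
        rw [← pow_mul, one_mul, ← pow_add]
        exact sub_ne_zero.2 (hqj _ (by omega)).symm)
      (fun i => by
        rw [← pow_mul, div_one, ← pow_add]
        exact sub_ne_zero.2 (hqj _ (by omega)).symm) (by omega)
    rw [h3n] at h
    simpa using h
  rw [hCC, hC0, h0A, hcf, hcf] at hcross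
  rw [hcf]
  have hbase : baseSum n q = C q * A q * Ψ q + (1 - (q ^ n) ^ 3) *
      ((1 - (q ^ n) ^ 2) ^ 2 * Y (q, 0)) - (1 - (q ^ n) ^ 3) *
      (((1 - (q ^ n) ^ 2) ^ 2 + (q ^ n) ^ 2 * C q) * (Y (q, 0) + C q * y (q, C q))) := by
    rw [mul_comm 3 n, pow_mul] at hcross
    have hy : Y (q, C q) = Y (q, 0) + C q * y (q, C q) := hy
    rw [hy] at hcross
    linear_combination hcross
  rw [hbase]
  simp only [B]
  have hCq : C q = -(1 - q ^ n) ^ 2 / q ^ n := rfl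
  have hAq : A q = -(1 - (q ^ n) ^ 3) ^ 2 / (q ^ n) ^ 3 := by
    simp only [A]
    rw [mul_comm 3 n, pow_mul]
  rw [mul_comm 2 n, mul_comm 3 n, pow_mul, pow_mul, hAq]
  generalize y (q, C q) = y0
  generalize Ψ q = Ψ0
  generalize Y (q, 0) = Y0
  rw [hCq]
  generalize q ^ n = x at *
  field_simp
  ring

end MainEstimate

section BlockDecomposition

open Filter Topology Asymptotics

lemma ContinuousAt.isTheta_one {f : ℂ → ℂ} {ζ : ℂ} (hf : ContinuousAt f ζ) (h0 : f ζ ≠ 0) :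
    f =Θ[𝓝 ζ] fun _ => (1 : ℂ) :=
  (isTheta_of_div_tendsto_nhds_ne_zero (by simpa using hf.tendsto) h0).symm

lemma isTheta_one_sub_pow {ζ : ℂ} {N : ℕ} (hN : 0 < N) (hζ : ζ ^ N = 1) :
    (fun q : ℂ => 1 - q ^ N) =Θ[𝓝 ζ] fun q => q - ζ := by
  have hζ0 : ζ ≠ 0 := fun h => by simp [h, hN.ne'] at hζ
  have h := ContinuousAt.isTheta_one (ζ := ζ)
    (f := fun q => -∑ i ∈ Finset.range N, q ^ i * ζ ^ (N - 1 - i)) (by fun_prop) (by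
      rw [geom_sum₂_self]
      exact neg_ne_zero.2 (mul_ne_zero (by exact_mod_cast hN.ne') (pow_ne_zero _ hζ0)))
  have h := h.mul (isTheta_refl (fun q => q - ζ) (𝓝 ζ))
  simp only [neg_mul, geom_sum₂_mul, hζ, neg_sub, one_mul] at h
  exact h

lemma qPoch_pow_add {K : Type*} [Field K] (q : K) (e s N k : ℕ) :
    qPoch (q ^ e) (q ^ s) (N + k) =
      qPoch (q ^ e) (q ^ s) N * qPoch (q ^ (e + s * N)) (q ^ s) k := by
  rw [qPoch, Finset.prod_range_add]
  congr 1
  refine Finset.prod_congr rfl fun i _ => ?_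
  rw [pow_add, pow_add, pow_mul]
  ring

lemma isTheta_qPoch_block {ζ : ℂ} {d : ℕ} (hζ : IsPrimitiveRoot ζ d) (hd : 0 < d) {e s : ℕ}
    (he : 0 < e) (hs : s.Coprime d) :
    (fun q : ℂ => qPoch (q ^ e) (q ^ s) d) =Θ[𝓝 ζ] fun q => q - ζ := by
  have hinj : ∀ i < d, ∀ j < d, d ∣ e + s * i → d ∣ e + s * j → i = j := by
    intro i hi j hj h1 h2
    have h : s * i ≡ s * j [MOD d] := Nat.ModEq.add_left_cancel' e
      ((Nat.modEq_zero_iff_dvd.2 h1).trans (Nat.modEq_zero_iff_dvd.2 h2).symm)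
    exact (Nat.ModEq.cancel_left_of_coprime (Nat.Coprime.symm hs) h).eq_of_lt_of_lt hi hj
  obtain ⟨i, hi, hdvd⟩ : ∃ i < d, d ∣ e + s * i := by
    have : NeZero d := ⟨hd.ne'⟩
    let u := ZMod.unitOfCoprime s hs
    refine ⟨(-(e : ZMod d) * (u⁻¹ : (ZMod d)ˣ)).val, ZMod.val_lt _, ?_⟩
    rw [← ZMod.natCast_eq_zero_iff]
    have hu : (s : ZMod d) * (u⁻¹ : (ZMod d)ˣ) = 1 := by
      rw [← ZMod.coe_unitOfCoprime s hs]
      exact u.mul_inv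
    push_cast
    rw [ZMod.natCast_zmod_val]
    linear_combination (-(e : ZMod d)) * hu
  have h1 := isTheta_one_sub_pow (N := e + s * i) (by omega) ((hζ.pow_eq_one_iff_dvd _).2 hdvd)
  have h2 := ContinuousAt.isTheta_one (ζ := ζ)
    (f := fun q => ∏ j ∈ (Finset.range d).erase i, (1 - q ^ (e + s * j))) (by fun_prop)
    (Finset.prod_ne_zero_iff.2 fun j hj => by
      obtain ⟨hji, hj⟩ := Finset.mem_erase.1 hj
      refine sub_ne_zero.2 fun h => hji ?_
      exact hinj j (Finset.mem_range.1 hj) i hi ((hζ.pow_eq_one_iff_dvd _).1 h.symm) hdvd)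
  have hprod : (fun q : ℂ => qPoch (q ^ e) (q ^ s) d) = fun q => (1 - q ^ (e + s * i)) *
      ∏ j ∈ (Finset.range d).erase i, (1 - q ^ (e + s * j)) := funext fun q => by
    rw [Finset.mul_prod_erase _ (fun j => 1 - q ^ (e + s * j)) (Finset.mem_range.2 hi), qPoch]
    exact Finset.prod_congr rfl fun j _ => by rw [pow_add, pow_mul]
  rw [hprod]
  simpa only [mul_one] using h1.mul h2

/-- The quotient of the terms of index `N + k` and `N` of the series, without the factors
`[6 * k + 1]`. -/
noncomputable def blockRatio (N k : ℕ) (q : ℂ) : ℂ :=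
  qPoch (q ^ (1 + 2 * N)) (q ^ 2) k ^ 2 * qPoch (q ^ (2 + 4 * N)) (q ^ 4) k *
    qPoch (q ^ (1 + 4 * N)) (q ^ 4) k ^ 2 /
    (qPoch (q ^ (2 + 2 * N)) (q ^ 2) k ^ 2 * qPoch (q ^ (4 + 4 * N)) (q ^ 4) k ^ 3) * q ^ (2 * k)

lemma blockRatio_add (N k : ℕ) (q : ℂ) :
    blockRatio 0 (N + k) q = blockRatio 0 N q * blockRatio N k q := by
  simp only [blockRatio, qPoch_pow_add, mul_zero, add_zero]
  rw [mul_add, pow_add]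
  simp only [div_eq_mul_inv, mul_inv, mul_pow]
  ring

lemma pairPoch_zero_right (s t k : ℕ) (q : ℂ) :
    pairPoch s t k (q, 0) = qPoch (q ^ s) (q ^ t) k ^ 2 := by
  rw [qPoch, ← Finset.prod_pow, pairPoch]
  refine Finset.prod_congr rfl fun i _ => ?_
  rw [pow_add, pow_mul]
  ring

lemma baseSum_eq (n : ℕ) (q : ℂ) :
    baseSum n q = ∑ k ∈ Finset.range n, (1 - q ^ (6 * k + 1)) * blockRatio 0 k q := by
  refine Finset.sum_congr rfl fun k _ => ?_
  simp only [weight, cPair, aPair, pairPoch_zero_right, blockRatio, mul_zero, add_zero, pow_one]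
  simp only [div_eq_mul_inv, mul_inv]
  ring

lemma qPoch_pow_ne_zero_of_lt {ζ : ℂ} {d : ℕ} (hζ : IsPrimitiveRoot ζ d) {s r : ℕ}
    (hs : s.Coprime d) (hr : r < d) : qPoch (ζ ^ s) (ζ ^ s) r ≠ 0 :=
  Finset.prod_ne_zero_iff.2 fun i hi => by
    have hi := Finset.mem_range.1 hi
    rw [← pow_succ', ← pow_mul]
    refine sub_ne_zero.2 fun h => ?_
    have := Nat.le_of_dvd (by omega)
      (hs.symm.dvd_of_dvd_mul_left ((hζ.pow_eq_one_iff_dvd _).1 h.symm))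
    omega

lemma IsPrimitiveRoot.pow_add_mul_mul {ζ : ℂ} {d : ℕ} (hζ : IsPrimitiveRoot ζ d) (e s j : ℕ) :
    ζ ^ (e + s * (j * d)) = ζ ^ e := by
  rw [pow_add, show s * (j * d) = d * (s * j) by ring, pow_mul, hζ.pow_eq_one, one_pow, mul_one]

lemma tendsto_blockRatio {ζ : ℂ} {d : ℕ} (hζ : IsPrimitiveRoot ζ d) (hd : Odd d) (j : ℕ) {r : ℕ}
    (hr : r < d) : Tendsto (blockRatio (j * d) r) (𝓝 ζ) (𝓝 (blockRatio 0 r ζ)) := by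
  have h2 : Nat.Coprime 2 d := Nat.coprime_two_left.2 hd
  have h4 : Nat.Coprime 4 d := Nat.Coprime.pow_left 2 h2
  have hval : blockRatio (j * d) r ζ = blockRatio 0 r ζ := by
    simp only [blockRatio, hζ.pow_add_mul_mul, mul_zero, add_zero]
  have hne : qPoch (ζ ^ (2 + 2 * (j * d))) (ζ ^ 2) r ^ 2 *
      qPoch (ζ ^ (4 + 4 * (j * d))) (ζ ^ 4) r ^ 3 ≠ 0 := by
    rw [hζ.pow_add_mul_mul, hζ.pow_add_mul_mul]
    exact mul_ne_zero (pow_ne_zero _ (qPoch_pow_ne_zero_of_lt hζ h2 hr))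
      (pow_ne_zero _ (qPoch_pow_ne_zero_of_lt hζ h4 hr))
  rw [← hval]
  change ContinuousAt (blockRatio (j * d) r) ζ
  unfold blockRatio
  fun_prop (disch := assumption)

lemma isTheta_blockRatio {ζ : ℂ} {d : ℕ} (hζ : IsPrimitiveRoot ζ d) (hd : Odd d) (j : ℕ) :
    blockRatio 0 (j * d) =Θ[𝓝[≠] ζ] fun _ => (1 : ℂ) := by
  have hd0 := hd.pos
  have h2 : Nat.Coprime 2 d := Nat.coprime_two_left.2 hd
  have h4 : Nat.Coprime 4 d := Nat.Coprime.pow_left 2 h2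
  have hζ0 : ζ ≠ 0 := hζ.ne_zero hd0.ne'
  induction j with
  | zero =>
    have h : blockRatio 0 (0 * d) = fun _ => 1 := funext fun q => by simp [blockRatio, qPoch_zero]
    rw [h]
  | succ j ih =>
    have hP : ∀ {e s : ℕ}, s.Coprime d → 0 < e →
        (fun q : ℂ => qPoch (q ^ e) (q ^ s) d) =Θ[𝓝[≠] ζ] fun q => q - ζ :=
      fun hs he => (isTheta_qPoch_block hζ hd0 he hs).mono nhdsWithin_le_nhds
    have hpow : (fun q : ℂ => q ^ (2 * d)) =Θ[𝓝[≠] ζ] fun _ => (1 : ℂ) :=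
      (ContinuousAt.isTheta_one (f := fun q => q ^ (2 * d)) (by fun_prop)
        (pow_ne_zero _ hζ0)).mono nhdsWithin_le_nhds
    have hb : blockRatio (j * d) d =Θ[𝓝[≠] ζ] fun q => (q - ζ) ^ 2 * (q - ζ) * (q - ζ) ^ 2 /
        ((q - ζ) ^ 2 * (q - ζ) ^ 3) * 1 :=
      (((((hP h2 (by omega)).pow 2).mul (hP h4 (by omega))).mul
        ((hP h4 (by omega)).pow 2)).div (((hP h2 (by omega)).pow 2).mul
        ((hP h4 (by omega)).pow 3))).mul hpow
    have hone : (fun q => (q - ζ) ^ 2 * (q - ζ) * (q - ζ) ^ 2 /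
        ((q - ζ) ^ 2 * (q - ζ) ^ 3) * 1) =ᶠ[𝓝[≠] ζ] fun _ => (1 : ℂ) := by
      filter_upwards [self_mem_nhdsWithin] with q hq
      have hq : q - ζ ≠ 0 := sub_ne_zero.2 hq
      field_simp
    have h : blockRatio 0 ((j + 1) * d) =
        fun q => blockRatio 0 (j * d) q * blockRatio (j * d) d q :=
      funext fun q => by rw [add_one_mul, blockRatio_add]
    rw [h]
    simpa only [mul_one] using ih.mul (hb.trans_eventuallyEq hone)

lemma tendsto_baseSum {ζ : ℂ} {d : ℕ} (hζ : IsPrimitiveRoot ζ d) (hd : Odd d) (hd1 : 1 < d)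
    (t : ℕ) : Tendsto (baseSum (t * d)) (𝓝[≠] ζ) (𝓝 0) := by
  induction t with
  | zero =>
    have h : baseSum (0 * d) = fun _ => 0 := funext fun q => by simp [baseSum]
    rw [h]
    exact tendsto_const_nhds
  | succ t ih =>
    have hsplit : baseSum ((t + 1) * d) = fun q => baseSum (t * d) q + blockRatio 0 (t * d) q *
        ∑ r ∈ Finset.range d, (1 - q ^ (6 * r + 1 + 6 * (t * d))) * blockRatio (t * d) r q :=
      funext fun q => by
        rw [add_one_mul, baseSum_eq, Finset.sum_range_add, ← baseSum_eq, Finset.mul_sum]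
        congr 1
        refine Finset.sum_congr rfl fun r _ => ?_
        rw [blockRatio_add, show 6 * (t * d + r) + 1 = 6 * r + 1 + 6 * (t * d) by ring]
        ring
    have hblock : Tendsto (fun q => ∑ r ∈ Finset.range d,
        (1 - q ^ (6 * r + 1 + 6 * (t * d))) * blockRatio (t * d) r q) (𝓝[≠] ζ) (𝓝 0) := by
      rw [← sum_weight_cPair_aPair_base hζ hd hd1, baseSum_eq]
      refine tendsto_finsetSum _ fun r hr => ?_
      have hpow : ContinuousAt (fun q : ℂ => 1 - q ^ (6 * r + 1 + 6 * (t * d))) ζ := by fun_prop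
      have h := hpow.tendsto.mul (tendsto_blockRatio hζ hd t (Finset.mem_range.1 hr))
      rw [hζ.pow_add_mul_mul] at h
      exact h.mono_left nhdsWithin_le_nhds
    rw [hsplit]
    have h0 := (isTheta_blockRatio hζ hd t).isBigO.mul_isLittleO ((isLittleO_one_iff ℂ).2 hblock)
    simp only [mul_one] at h0
    simpa only [add_zero] using ih.add ((isLittleO_one_iff ℂ).1 h0)

lemma isBigO_closedForm {ζ : ℂ} {d : ℕ} (hζ : IsPrimitiveRoot ζ d) (hd : Odd d) (M : ℕ) :
    (fun q => closedForm M (q, 0)) =O[𝓝[≠] ζ] fun _ => (1 : ℂ) := by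
  have hd0 := hd.pos
  have h4 : Nat.Coprime 4 d := Nat.Coprime.pow_left 2 (Nat.coprime_two_left.2 hd)
  have hblock : ∀ j, (fun q : ℂ => qPoch (q ^ 2) (q ^ 4) (j * d) / qPoch (q ^ 4) (q ^ 4) (j * d))
      =O[𝓝[≠] ζ] fun _ => (1 : ℂ) := fun j => by
    induction j with
    | zero => simp [qPoch_zero, isBigO_refl]
    | succ j ih =>
      have hP : ∀ {e : ℕ}, 0 < e →
          (fun q : ℂ => qPoch (q ^ e) (q ^ 4) d) =Θ[𝓝[≠] ζ] fun q => q - ζ :=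
        fun he => (isTheta_qPoch_block hζ hd0 he h4).mono nhdsWithin_le_nhds
      have hone : (fun q => (q - ζ) / (q - ζ)) =ᶠ[𝓝[≠] ζ] fun _ => (1 : ℂ) := by
        filter_upwards [self_mem_nhdsWithin] with q hq
        exact div_self (sub_ne_zero.2 hq)
      have h := ih.mul ((((hP (e := 2 + 4 * (j * d)) (by omega)).div
        (hP (e := 4 + 4 * (j * d)) (by omega))).trans_eventuallyEq hone).isBigO)
      simpa only [add_one_mul, qPoch_pow_add, div_mul_div_comm, mul_one] using h
  have hrest : ContinuousAt (fun q : ℂ => qPoch (q ^ (2 + 4 * (M / d * d))) (q ^ 4) (M % d) /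
      qPoch (q ^ (4 + 4 * (M / d * d))) (q ^ 4) (M % d)) ζ := by
    have hne : qPoch (ζ ^ (4 + 4 * (M / d * d))) (ζ ^ 4) (M % d) ≠ 0 := by
      rw [hζ.pow_add_mul_mul]
      exact qPoch_pow_ne_zero_of_lt hζ h4 (Nat.mod_lt _ hd0)
    fun_prop (disch := assumption)
  have h := ((hblock (M / d)).mul
    ((hrest.tendsto.mono_left nhdsWithin_le_nhds).isBigO_one ℂ)).pow 2
  simp only [div_mul_div_comm, ← qPoch_pow_add, Nat.div_add_mod', mul_one, one_pow, div_pow,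
    ← pairPoch_zero_right] at h
  exact h

lemma tendsto_baseSum_sub {ζ : ℂ} {d n : ℕ} (hζ : IsPrimitiveRoot ζ d) (hd : Odd d) (hd1 : 1 < d)
    (hdn : d ∣ n) (M : ℕ) :
    Tendsto (fun q : ℂ => baseSum n q - (1 - q ^ (3 * n)) *
      (q ^ (2 * n) * (2 - q ^ n) / (1 + q ^ n) ^ 2) * closedForm M (q, 0)) (𝓝[≠] ζ) (𝓝 0) := by
  obtain ⟨t, rfl⟩ := hdn
  have hpow : ζ ^ (d * t) = 1 := by rw [pow_mul, hζ.pow_eq_one, one_pow]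
  have hfac : ContinuousAt (fun q : ℂ => (1 - q ^ (3 * (d * t))) *
      (q ^ (2 * (d * t)) * (2 - q ^ (d * t)) / (1 + q ^ (d * t)) ^ 2)) ζ := by
    have hne : (1 + ζ ^ (d * t)) ^ 2 ≠ 0 := by
      rw [hpow]
      norm_num
    fun_prop (disch := assumption)
  have hfac0 := hfac.tendsto.mono_left (nhdsWithin_le_nhds (s := {ζ}ᶜ))
  rw [mul_comm 3, pow_mul ζ, hpow, one_pow, sub_self, zero_mul] at hfac0
  have h := ((isLittleO_one_iff ℂ).2 hfac0).mul_isBigO (isBigO_closedForm hζ hd M)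
  simp only [mul_one, mul_comm _ 3] at h
  have hsum := tendsto_baseSum hζ hd hd1 t
  rw [mul_comm] at hsum
  simpa only [sub_zero] using hsum.sub ((isLittleO_one_iff ℂ).1 h)

end BlockDecomposition

section Transfer

open Filter Topology Asymptotics Polynomial nonZeroDivisors

lemma map_qPoch {K L : Type*} [Field K] [Field L] (φ : K →+* L) (x q : K) (k : ℕ) :
    φ (qPoch x q k) = qPoch (φ x) (φ q) k := by
  simp [qPoch]

lemma map_qint {K L : Type*} [Field K] [Field L] (φ : K →+* L) (q : K) (r : ℕ) :
    φ (qint q r) = qint (φ q) r := by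
  simp [qint]

lemma one_sub_mul_qint {K : Type*} [Field K] (q : K) (r : ℕ) : (1 - q) * qint q r = 1 - q ^ r :=
  mul_neg_geom_sum q r

/-- The difference of the two sides of the congruence, as an element of an arbitrary field. -/
def congruenceDefect {K : Type*} [Field K] (n : ℕ) (q : K) : K :=
  (∑ k ∈ Finset.range n, qint q (6 * k + 1) * qPoch q (q ^ 2) k ^ 2 * qPoch (q ^ 2) (q ^ 4) k *
      qPoch q (q ^ 4) k ^ 2 / (qPoch (q ^ 2) (q ^ 2) k ^ 2 * qPoch (q ^ 4) (q ^ 4) k ^ 3) *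
      q ^ (2 * k)) -
    qint q (3 * n) * (q ^ (2 * n) * (2 - q ^ n) / (1 + q ^ n) ^ 2) *
      (qPoch (q ^ 2) (q ^ 4) ((3 * n - 1) / 4) ^ 2 / qPoch (q ^ 4) (q ^ 4) ((3 * n - 1) / 4) ^ 2)

lemma map_congruenceDefect {K L : Type*} [Field K] [Field L] (φ : K →+* L) (n : ℕ) (q : K) :
    φ (congruenceDefect n q) = congruenceDefect n (φ q) := by
  have h2 : φ 2 = 2 := map_ofNat φ 2
  simp [congruenceDefect, map_qPoch, map_qint, h2]

lemma one_sub_mul_congruenceDefect (n : ℕ) (q : ℂ) :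
    (1 - q) * congruenceDefect n q = baseSum n q - (1 - q ^ (3 * n)) *
      (q ^ (2 * n) * (2 - q ^ n) / (1 + q ^ n) ^ 2) * closedForm ((3 * n - 1) / 4) (q, 0) := by
  rw [congruenceDefect, closedForm, pairPoch_zero_right, pairPoch_zero_right, baseSum_eq, mul_sub,
    Finset.mul_sum, ← one_sub_mul_qint]
  congr 1
  · refine Finset.sum_congr rfl fun k _ => ?_
    rw [← one_sub_mul_qint, blockRatio]
    simp only [mul_zero, add_zero, pow_one]
    ring
  · ring

lemma aeval_num_mul {q : ℂ} (hq : Transcendental ℚ q) (n : ℕ) :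
    aeval q (congruenceDefect n (RatFunc.X : RatFunc ℚ)).num * (1 - q) =
      aeval q (congruenceDefect n (RatFunc.X : RatFunc ℚ)).denom *
        (baseSum n q - (1 - q ^ (3 * n)) *
          (q ^ (2 * n) * (2 - q ^ n) / (1 + q ^ n) ^ 2) * closedForm ((3 * n - 1) / 4) (q, 0)) := by
  have hinj : Function.Injective (aeval (R := ℚ) q) := transcendental_iff_injective.1 hq
  have hle : ℚ[X]⁰ ≤ (ℂ)⁰.comap (aeval (R := ℚ) q) :=
    nonZeroDivisors_le_comap_nonZeroDivisors_of_injective _ hinj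
  let φ : RatFunc ℚ →+* ℂ := RatFunc.liftRingHom (aeval (R := ℚ) q : ℚ[X] →+* ℂ) hle
  have hφ : ∀ f, φ f = aeval q f.num / aeval q f.denom := fun f =>
    RatFunc.liftRingHom_apply _ hle f
  have hX : φ RatFunc.X = q := by simp [hφ]
  have hden : aeval q (congruenceDefect n (RatFunc.X : RatFunc ℚ)).denom ≠ 0 :=
    (map_ne_zero_iff _ hinj).2 (RatFunc.denom_ne_zero _)
  have h : φ (congruenceDefect n RatFunc.X) = congruenceDefect n q := by
    rw [← hX]
    exact map_congruenceDefect φ n RatFunc.X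
  rw [hφ, div_eq_iff hden] at h
  rw [← one_sub_mul_congruenceDefect, h]
  ring

lemma cyclotomic_dvd_of_tendsto {ζ : ℂ} {d : ℕ} (hζ : IsPrimitiveRoot ζ d) (hd : 0 < d)
    {P : ℚ[X]} (hP : Tendsto (fun q : ℂ => aeval q P) (𝓝[transcendentalDisc] ζ) (𝓝 0)) :
    cyclotomic d ℚ ∣ P := by
  have := transcendentalDisc_nhdsWithin_neBot (hζ.norm'_eq_one hd.ne')
  have hcont : Tendsto (fun q : ℂ => aeval q P) (𝓝[transcendentalDisc] ζ) (𝓝 (aeval ζ P)) :=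
    P.continuous_aeval.continuousAt.mono_left nhdsWithin_le_nhds
  rw [cyclotomic_eq_minpoly_rat hζ hd]
  exact minpoly.dvd _ _ (tendsto_nhds_unique hcont hP)

lemma nhdsWithin_transcendentalDisc_le {ζ : ℂ} (hζ : ‖ζ‖ = 1) :
    𝓝[transcendentalDisc] ζ ≤ 𝓝[≠] ζ :=
  nhdsWithin_mono _ fun q hq h => by
    have := hq.1
    rw [h, hζ] at this
    exact lt_irrefl _ this

lemma cyclotomic_pow_dvd_of_isBigO {ζ : ℂ} {n : ℕ} (hζ : IsPrimitiveRoot ζ n) (hn : 0 < n) (k : ℕ)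
    {P : ℚ[X]}
    (hP : (fun q : ℂ => aeval q P) =O[𝓝[transcendentalDisc] ζ] fun q => (q - ζ) ^ k) :
    cyclotomic n ℚ ^ k ∣ P := by
  have hle := nhdsWithin_transcendentalDisc_le (hζ.norm'_eq_one hn.ne')
  induction k generalizing P with
  | zero => simp
  | succ k ih =>
    have hlin : Tendsto (fun q : ℂ => (q - ζ) ^ (k + 1)) (𝓝[transcendentalDisc] ζ) (𝓝 0) := by
      have h : ContinuousAt (fun q : ℂ => (q - ζ) ^ (k + 1)) ζ := by fun_prop
      simpa using h.tendsto.mono_left nhdsWithin_le_nhds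
    obtain ⟨R, rfl⟩ := cyclotomic_dvd_of_tendsto hζ hn (hP.trans_tendsto hlin)
    rw [pow_succ']
    refine mul_dvd_mul_left _ (ih ?_)
    obtain ⟨S, hS⟩ := cyclotomic.dvd_X_pow_sub_one n ℚ
    have hΦ : (fun q : ℂ => q - ζ) =O[𝓝[transcendentalDisc] ζ]
        fun q => aeval q (cyclotomic n ℚ) := by
      refine ((isTheta_one_sub_pow hn hζ.pow_eq_one).mono nhdsWithin_le_nhds).symm.isBigO.trans ?_
      have hS1 : (fun q : ℂ => -aeval q S) =O[𝓝[transcendentalDisc] ζ] fun _ => (1 : ℂ) :=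
        (S.continuous_aeval.neg.continuousAt.tendsto.mono_left nhdsWithin_le_nhds).isBigO_one ℂ
      refine ((isBigO_refl (fun q : ℂ => aeval q (cyclotomic n ℚ)) _).mul hS1).congr
        (fun q => ?_) fun q => mul_one _
      rw [mul_neg, ← map_mul, ← hS]
      simp
    have hprod : (fun q : ℂ => (q - ζ) * aeval q R) =O[𝓝[transcendentalDisc] ζ]
        fun q => (q - ζ) * (q - ζ) ^ k := by
      simp only [← pow_succ']
      refine (hΦ.mul (isBigO_refl (fun q : ℂ => aeval q R) _)).trans ?_
      simpa only [map_mul] using hP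
    have hinv := (isBigO_refl (fun q : ℂ => (q - ζ)⁻¹) (𝓝[transcendentalDisc] ζ)).mul hprod
    refine hinv.congr' ?_ ?_ <;>
    · filter_upwards [hle self_mem_nhdsWithin] with q hq
      exact inv_mul_cancel_left₀ (sub_ne_zero.2 hq) _

lemma aeval_num_isBigO {ζ : ℂ} (hζ1 : ζ ≠ 1) (n : ℕ) :
    (fun q : ℂ => aeval q (congruenceDefect n (RatFunc.X : RatFunc ℚ)).num)
      =O[𝓝[transcendentalDisc] ζ] fun q => baseSum n q - (1 - q ^ (3 * n)) *
        (q ^ (2 * n) * (2 - q ^ n) / (1 + q ^ n) ^ 2) * closedForm ((3 * n - 1) / 4) (q, 0) := by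
  have hne : 1 - ζ ≠ 0 := sub_ne_zero.2 hζ1.symm
  have hcont : ContinuousAt (fun q : ℂ =>
      aeval q (congruenceDefect n (RatFunc.X : RatFunc ℚ)).denom / (1 - q)) ζ :=
    (Polynomial.continuous_aeval _).continuousAt.div (by fun_prop) hne
  have h1 := (hcont.tendsto.mono_left (nhdsWithin_le_nhds (s := transcendentalDisc))).isBigO_one ℂ
  have h := h1.mul (isBigO_refl (fun q => baseSum n q - (1 - q ^ (3 * n)) *
    (q ^ (2 * n) * (2 - q ^ n) / (1 + q ^ n) ^ 2) * closedForm ((3 * n - 1) / 4) (q, 0)) _)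
  refine h.congr' ?_ (Eventually.of_forall fun q => one_mul _)
  filter_upwards [self_mem_nhdsWithin] with q hq
  have hq1 : 1 - q ≠ 0 := sub_ne_zero.2 fun h => pow_ne_one_of_norm_lt_one hq.1 one_pos (by
    rw [pow_one, ← h])
  rw [div_mul_eq_mul_div, ← aeval_num_mul hq.2, mul_div_assoc, div_self hq1, mul_one]

end Transfer

theorem stmt_8 (n : ℕ) (hn : 0 < n) (h4 : n % 4 = 3) :
    ((∑ i ∈ Finset.range n, (Polynomial.X : Polynomial ℚ) ^ i) *
        Polynomial.cyclotomic n ℚ ^ 4) ∣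
      ((∑ k ∈ Finset.range n,
          qint (RatFunc.X : RatFunc ℚ) (6 * k + 1) *
            qPoch RatFunc.X (RatFunc.X ^ 2) k ^ 2 *
            qPoch ((RatFunc.X : RatFunc ℚ) ^ 2) (RatFunc.X ^ 4) k *
            qPoch RatFunc.X (RatFunc.X ^ 4) k ^ 2 /
            (qPoch ((RatFunc.X : RatFunc ℚ) ^ 2) (RatFunc.X ^ 2) k ^ 2 *
              qPoch ((RatFunc.X : RatFunc ℚ) ^ 4) (RatFunc.X ^ 4) k ^ 3) *
            RatFunc.X ^ (2 * k)) -
        qint (RatFunc.X : RatFunc ℚ) (3 * n) *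
          ((RatFunc.X : RatFunc ℚ) ^ (2 * n) * (2 - (RatFunc.X : RatFunc ℚ) ^ n) /
            (1 + (RatFunc.X : RatFunc ℚ) ^ n) ^ 2) *
          (qPoch ((RatFunc.X : RatFunc ℚ) ^ 2) (RatFunc.X ^ 4) ((3 * n - 1) / 4) ^ 2 /
            qPoch ((RatFunc.X : RatFunc ℚ) ^ 4) (RatFunc.X ^ 4) ((3 * n - 1) / 4) ^ 2)).num := by
  rw [← congruenceDefect, ← Polynomial.prod_cyclotomic_eq_geom_sum hn,
    ← Finset.mul_prod_erase (n.divisors.erase 1) (fun i => Polynomial.cyclotomic i ℚ)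
      (Finset.mem_erase.2 ⟨by omega, Nat.mem_divisors_self n hn.ne'⟩), mul_right_comm, ← pow_succ']
  have hcop : ∀ {i j : ℕ}, i ≠ j →
      IsCoprime (Polynomial.cyclotomic i ℚ) (Polynomial.cyclotomic j ℚ) :=
    fun hij => Polynomial.cyclotomic.isCoprime_rat hij
  refine IsCoprime.mul_dvd (IsCoprime.pow_left (IsCoprime.prod_right fun d hd =>
    hcop (Finset.ne_of_mem_erase hd).symm)) ?_ ?_
  · have hζ := Complex.isPrimitiveRoot_exp n hn.ne'
    refine cyclotomic_pow_dvd_of_isBigO hζ hn 5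
      ((aeval_num_isBigO (hζ.ne_one (by omega)) n).trans ?_)
    exact baseSum_sub_isBigO (m := n / 4) (by omega) (by omega) hζ
  · refine Finset.prod_dvd_of_coprime (fun i _ j _ hij => hcop hij) fun d hd => ?_
    simp only [Finset.mem_erase, Nat.mem_divisors] at hd
    obtain ⟨-, hd1, hdn, -⟩ := hd
    have hd0 : 0 < d := Nat.pos_of_dvd_of_pos hdn hn
    have hodd : Odd d := Odd.of_dvd_nat (Nat.odd_iff.2 (by omega)) hdn
    have hζ := Complex.isPrimitiveRoot_exp d hd0.ne'
    refine cyclotomic_dvd_of_tendsto hζ hd0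
      ((aeval_num_isBigO (hζ.ne_one (by omega)) n).trans_tendsto ?_)
    exact (tendsto_baseSum_sub hζ hodd (by omega) hdn _).mono_left
      (nhdsWithin_transcendentalDisc_le (hζ.norm'_eq_one hd0.ne'))
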